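/- arXiv:1309.6246 — 3 statements merged into one kernel-verified Lean document; each statement's English description precedes it below -/
import Mathlib

section
/- Let T be an invertible measure-preserving transformation of the unit interval [0,1] equipped with Lebesgue measure μ such that T^n is ergodic for every integer n ≥ 1 (i.e. T is completely ergodic). Then there exists an increasing sequence (a_n) of positive real numbers with a_n → ∞ and a_n/n → 0 such that for every measurable set E ⊆ [0,1] with 0 < μ(E) < 1, the binary partition P = {E, [0,1]∖E} satisfies liminf_{n→∞} H(g₀, P_n)/a_n ≥ 1, where g₀(x) = x·log₂(1 − log₂ x) for x ∈ (0,1] and g₀(0) = 0. -/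
open MeasureTheory Filter Set

/-- The atom of the join partition `P ∨ T⁻¹P ∨ ⋯ ∨ T^{-(n-1)}P` of the binary partition
`{E, Eᶜ}` corresponding to the 01-name `s`. -/
def cyl {X : Type*} (T : X → X) (E : Set X) (n : ℕ) (s : Fin n → Bool) : Set X :=
  {x | ∀ i : Fin n, (T^[(i : ℕ)] x ∈ E ↔ s i = true)}

/-- The `g`-entropy `H(g, P_n)` of the join partition `P_n` of the binary partition
`P = {E, Eᶜ}`. Atoms with measure zero contribute `g 0 = 0`. -/
noncomputable def binEnt {X : Type*} [MeasurableSpace X] (μ : Measure X)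
    (T : X → X) (g : ℝ → ℝ) (E : Set X) (n : ℕ) : ℝ :=
  ∑ s : Fin n → Bool, g ((μ (cyl T E n s)).toReal)

/-- The function `g₀(x) = x·log₂(1 − log₂ x)` for `x ∈ (0,1]`, `g₀(0) = 0`. -/
noncomputable def g0 : ℝ → ℝ := fun x =>
  if x = 0 then 0 else x * Real.logb 2 (1 - Real.logb 2 x)

open scoped InnerProductSpace in
/-- The mean ergodic theorem with a rate along a sequence of contractions of a separable Hilbert
space: the rate `N` does not depend on the vector. -/
theorem exists_uniform_birkhoffAverage_rate {V : Type*} [NormedAddCommGroup V]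
    [InnerProductSpace ℝ V] [CompleteSpace V] [TopologicalSpace.SeparableSpace V]
    (U : ℕ → V →L[ℝ] V) (hU : ∀ k, ‖U k‖ ≤ 1) :
    ∃ N : ℕ → ℕ, ∀ x : V, ∀ ε > 0, ∃ M₀ : ℕ, ∀ M ≥ M₀, ∀ m ≥ N M,
      ‖birkhoffAverage ℝ (U M) _root_.id m x
        - ((U M).eqLocus (1 : V →L[ℝ] V)).starProjection x‖ < ε := by
  set u : ℕ → V := TopologicalSpace.denseSeq V
  have key : ∀ M : ℕ, ∃ N : ℕ, ∀ m ≥ N, ∀ j ≤ M, ‖birkhoffAverage ℝ (U M) _root_.id m (u j)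
        - ((U M).eqLocus (1 : V →L[ℝ] V)).starProjection (u j)‖ < 1 / ((M : ℝ) + 1) := by
    intro M
    rw [← eventually_atTop]
    have : ∀ᶠ m in atTop, ∀ j ∈ Finset.Iic M, ‖birkhoffAverage ℝ (U M) _root_.id m (u j)
        - ((U M).eqLocus (1 : V →L[ℝ] V)).starProjection (u j)‖ < 1 / ((M : ℝ) + 1) := by
      rw [eventually_all_finset]
      intro j _
      have h := (U M).tendsto_birkhoffAverage_orthogonalProjection (hU M) (u j)
      have h2 := (tendsto_iff_norm_sub_tendsto_zero.1 h)
      exact h2.eventually_lt_const (by positivity)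
    filter_upwards [this] with m hm j hj using hm j (by simpa using hj)
  choose N hN using key
  refine ⟨N, fun x ε hε ↦ ?_⟩
  obtain ⟨j, hj⟩ := (TopologicalSpace.denseRange_denseSeq V).exists_dist_lt x
    (show 0 < ε / 3 by positivity)
  obtain ⟨M₁, hM₁⟩ := exists_nat_one_div_lt (show 0 < ε / 3 by positivity)
  refine ⟨max j M₁, fun M hM m hm ↦ ?_⟩
  have h1 := hN M m hm j (le_trans (le_max_left _ _) hM)
  have h2 : 1 / ((M : ℝ) + 1) ≤ 1 / ((M₁ : ℝ) + 1) := by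
    have : (M₁ : ℝ) ≤ M := by exact_mod_cast le_trans (le_max_right _ _) hM
    gcongr
  have h3 : dist (birkhoffAverage ℝ (U M) _root_.id m x)
      (birkhoffAverage ℝ (U M) _root_.id m (u j)) ≤ dist x (u j) := by
    refine (dist_birkhoffAverage_birkhoffAverage_le _ _ _ _ _ _).trans ?_
    refine div_le_of_le_mul₀ (by positivity) dist_nonneg ?_
    calc _ ≤ ∑ k ∈ Finset.range m, dist x (u j) := by
          refine Finset.sum_le_sum fun k _ ↦ ?_
          have hL : LipschitzWith 1 (U M) := (U M).lipschitz.weaken (hU M)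
          simpa using (hL.iterate k).dist_le_mul x (u j)
      _ = _ := by simp [mul_comm]
  have h4 : ‖((U M).eqLocus (1 : V →L[ℝ] V)).starProjection (u j)
      - ((U M).eqLocus (1 : V →L[ℝ] V)).starProjection x‖ ≤ dist x (u j) := by
    rw [← map_sub, dist_comm, dist_eq_norm]
    exact Submodule.norm_starProjection_apply_le _ _
  rw [dist_eq_norm] at h3
  have h5 := norm_add₃_le (a := birkhoffAverage ℝ (U M) _root_.id m x
      - birkhoffAverage ℝ (U M) _root_.id m (u j))
    (b := birkhoffAverage ℝ (U M) _root_.id m (u j)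
        - ((U M).eqLocus (1 : V →L[ℝ] V)).starProjection (u j))
    (c := ((U M).eqLocus (1 : V →L[ℝ] V)).starProjection (u j)
      - ((U M).eqLocus (1 : V →L[ℝ] V)).starProjection x)
  simp only [sub_add_sub_cancel] at h5
  linarith

/-- The Koopman operator of a measure-preserving map on `L²`. -/
noncomputable def koopman {X : Type*} [MeasurableSpace X] {μ : Measure X} {S : X → X}
    (hS : MeasurePreserving S μ μ) : Lp ℝ 2 μ →L[ℝ] Lp ℝ 2 μ :=
  (Lp.compMeasurePreservingₗᵢ ℝ S hS).toContinuousLinearMap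

section koopman
variable {X : Type*} [MeasurableSpace X] {μ : Measure X} {S : X → X}

theorem norm_koopman_le (hS : MeasurePreserving S μ μ) : ‖koopman hS‖ ≤ 1 :=
  LinearIsometry.norm_toContinuousLinearMap_le _

theorem koopman_iterate_indicator [IsFiniteMeasure μ] (hS : MeasurePreserving S μ μ) {E : Set X}
    (hE : MeasurableSet E) (n : ℕ) :
    (koopman hS)^[n] (indicatorConstLp 2 hE (measure_ne_top μ E) 1) =
      indicatorConstLp 2 (hE.preimage (hS.iterate n).measurable) (measure_ne_top μ _) 1 := by
  have : (koopman hS : Lp ℝ 2 μ → Lp ℝ 2 μ) = Lp.compMeasurePreserving S hS := rfl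
  rw [this, Lp.compMeasurePreserving_iterate]
  rfl

theorem Ergodic.starProjection_koopman_indicator [IsProbabilityMeasure μ] (hS : Ergodic S μ)
    {E : Set X} (hE : MeasurableSet E) :
    ((koopman hS.toMeasurePreserving).eqLocus (1 : Lp ℝ 2 μ →L[ℝ] Lp ℝ 2 μ)).starProjection
      (indicatorConstLp 2 hE (measure_ne_top μ E) 1) =
      μ.real E • indicatorConstLp 2 MeasurableSet.univ (measure_ne_top μ univ) (1 : ℝ) := by
  refine Submodule.eq_starProjection_of_mem_of_inner_eq_zero ?_ ?_
  · have := koopman_iterate_indicator hS.toMeasurePreserving MeasurableSet.univ 1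
    simp only [Function.iterate_one, preimage_univ] at this
    refine Submodule.smul_mem _ _ ?_
    rw [LinearMap.mem_eqLocus]
    exact this
  · intro w hw
    obtain ⟨d, hd⟩ : ∃ d : ℝ, w =
        d • indicatorConstLp 2 MeasurableSet.univ (measure_ne_top μ univ) (1 : ℝ) := by
      have hw' : Lp.compMeasurePreserving S hS.toMeasurePreserving w = w := hw
      have h2 : (w : X →ₘ[μ] ℝ).compMeasurePreserving S hS.toMeasurePreserving = w :=
        congrArg Subtype.val hw'
      obtain ⟨d, hd⟩ := hS.eq_const_of_compMeasurePreserving_eq h2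
      refine ⟨d, ?_⟩
      have h3 : w = Lp.const 2 μ d := Subtype.ext hd
      rw [h3, indicatorConstLp_univ]
      have := (Lp.constₗ 2 μ ℝ).map_smul d (1 : ℝ)
      simpa using this
    rw [hd, inner_sub_left, inner_smul_left, inner_smul_right, inner_smul_right,
      L2.real_inner_indicatorConstLp_one_indicatorConstLp_one,
      L2.real_inner_indicatorConstLp_one_indicatorConstLp_one]
    simp
    ring

/-- If the visits to `E` are constant for time `m` on `G`, then the Birkhoff averages of `1_E` are
far from the mean. -/
theorem measure_mul_min_le_norm_birkhoffAverage_sub [IsProbabilityMeasure μ]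
    (hS : MeasurePreserving S μ μ) {E G : Set X} (hE : MeasurableSet E) (hG : MeasurableSet G)
    {m : ℕ} (hm : m ≠ 0) (h : ∀ y ∈ G, ∀ t < m, (S^[t] y ∈ E ↔ y ∈ E)) :
    μ.real G * min (μ.real E) (1 - μ.real E) ≤
      2 * ‖birkhoffAverage ℝ (koopman hS) _root_.id m
          (indicatorConstLp 2 hE (measure_ne_top μ E) 1) -
        μ.real E • indicatorConstLp 2 MeasurableSet.univ (measure_ne_top μ univ) (1 : ℝ)‖ := by
  set D := birkhoffAverage ℝ (koopman hS) _root_.id m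
          (indicatorConstLp 2 hE (measure_ne_top μ E) 1) -
        μ.real E • indicatorConstLp 2 MeasurableSet.univ (measure_ne_top μ univ) (1 : ℝ) with hD
  have hm' : (m : ℝ) ≠ 0 := by exact_mod_cast hm
  have inn : ∀ {F : Set X} (hF : MeasurableSet F) (r : ℝ),
      (∀ t < m, μ.real (F ∩ S^[t] ⁻¹' E) = r) →
      inner ℝ (indicatorConstLp 2 hF (measure_ne_top μ F) (1 : ℝ)) D
        = r - μ.real E * μ.real F := by
    intro F hF r hr
    rw [hD, inner_sub_right, inner_smul_right,
      L2.real_inner_indicatorConstLp_one_indicatorConstLp_one, inter_univ, birkhoffAverage,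
      birkhoffSum, inner_smul_right, inner_sum]
    congr 1
    rw [Finset.sum_congr rfl (g := fun _ ↦ r)]
    · simp [hm']
    · intro t ht
      rw [id, koopman_iterate_indicator, L2.real_inner_indicatorConstLp_one_indicatorConstLp_one]
      exact hr t (by simpa using ht)
  have nrm : ∀ {F : Set X} (hF : MeasurableSet F),
      ‖indicatorConstLp 2 hF (measure_ne_top μ F) (1 : ℝ)‖ ≤ 1 := by
    intro F hF
    refine (norm_indicatorConstLp_le).trans ?_
    rw [norm_one, one_mul]
    exact Real.rpow_le_one measureReal_nonneg measureReal_le_one (by positivity)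
  have cs : ∀ {F : Set X} (hF : MeasurableSet F),
      |inner ℝ (indicatorConstLp 2 hF (measure_ne_top μ F) (1 : ℝ)) D| ≤ ‖D‖ := by
    intro F hF
    refine (abs_real_inner_le_norm _ _).trans ?_
    exact mul_le_of_le_one_left (norm_nonneg _) (nrm hF)
  have i1 := inn (hG.inter hE) (μ.real (G ∩ E)) (by
    intro t ht
    congr 1
    ext y
    simp only [mem_inter_iff, mem_preimage]
    constructor
    · tauto
    · rintro ⟨a, b⟩
      exact ⟨⟨a, b⟩, (h y a t ht).2 b⟩)
  have i2 := inn (hG.diff hE) 0 (by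
    intro t ht
    rw [show (G \ E) ∩ S^[t] ⁻¹' E = ∅ from ?_, measureReal_empty]
    ext y
    simp only [mem_inter_iff, mem_preimage, Set.mem_sdiff, mem_empty_iff_false, iff_false]
    rintro ⟨⟨a, b⟩, c⟩
    exact b ((h y a t ht).1 c))
  have c1 := (abs_le.1 (cs (hG.inter hE))).2
  have c2 := (abs_le.1 (cs (hG.diff hE))).1
  rw [i1] at c1
  rw [i2] at c2
  have hsum : μ.real (G ∩ E) + μ.real (G \ E) = μ.real G := measureReal_inter_add_sdiff hE
  have p1 : 0 ≤ μ.real (G ∩ E) := measureReal_nonneg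
  have p2 : 0 ≤ μ.real (G \ E) := measureReal_nonneg
  have q1 := mul_le_mul_of_nonneg_left (min_le_right (μ.real E) (1 - μ.real E)) p1
  have q2 := mul_le_mul_of_nonneg_left (min_le_left (μ.real E) (1 - μ.real E)) p2
  rw [← hsum, add_mul]
  linarith
end koopman

theorem mem_iterate_add_mul_iff_of_name_eq {X : Type*} {T : X → X} {E : Set X} {n i p r q : ℕ}
    {x : X} (h : ∀ l < n, (T^[l] (T^[i] x) ∈ E ↔ T^[l] (T^[i + p] x) ∈ E)) (hp : 0 < p)
    (hi : i ≤ r) (hpq : p ∣ q) {t : ℕ} (ht : r + t * q ≤ n) :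
    T^[r + t * q] x ∈ E ↔ T^[r] x ∈ E := by
  have key : ∀ s : ℕ, r + s * p ≤ n → (T^[r + s * p] x ∈ E ↔ T^[r] x ∈ E) := by
    intro s
    induction s with
    | zero => simp
    | succ s ih =>
      intro hs
      rw [add_mul, one_mul] at hs
      have := h (r + s * p - i) (by omega)
      rw [← Function.iterate_add_apply, ← Function.iterate_add_apply,
        show r + s * p - i + i = r + s * p by omega,
        show r + s * p - i + (i + p) = r + (s + 1) * p by rw [add_mul, one_mul]; omega] at this
      rw [← this]
      exact ih (by omega)
  obtain ⟨c, rfl⟩ := hpq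
  have := key (t * c) (by rw [mul_assoc, mul_comm c p]; exact ht)
  rwa [mul_assoc, mul_comm c p] at this

theorem measurableSet_cyl {X : Type*} [MeasurableSpace X] {T : X → X} (hT : Measurable T)
    {E : Set X} (hE : MeasurableSet E) (n : ℕ) (s : Fin n → Bool) :
    MeasurableSet (cyl T E n s) := by
  have : cyl T E n s = ⋂ i : Fin n, {x | T^[(i : ℕ)] x ∈ E ↔ s i = true} := by
    ext x; simp [cyl]
  rw [this]
  refine MeasurableSet.iInter fun i ↦ ?_
  exact MeasurableSet.iff ((hT.iterate i) hE) (MeasurableSet.const _)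

open Classical in
/-- The `n`-name of a point. -/
noncomputable def orbitName {X : Type*} (T : X → X) (E : Set X) (n : ℕ) (x : X) : Fin n → Bool :=
  fun i ↦ decide (T^[(i : ℕ)] x ∈ E)

theorem mem_cyl_iff {X : Type*} {T : X → X} {E : Set X} {n : ℕ} {s : Fin n → Bool} {x : X} :
    x ∈ cyl T E n s ↔ orbitName T E n x = s := by
  simp only [cyl, mem_ofPred_eq, orbitName, funext_iff]
  refine forall_congr' fun i ↦ ?_
  cases s i <;> simp

theorem measureReal_preimage_orbitName {X : Type*} [MeasurableSpace X] {μ : Measure X}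
    [IsFiniteMeasure μ] {T : X → X} (hT : Measurable T) {E : Set X} (hE : MeasurableSet E) (n : ℕ)
    (A : Finset (Fin n → Bool)) :
    μ.real (orbitName T E n ⁻¹' A) = ∑ s ∈ A, μ.real (cyl T E n s) := by
  rw [← measureReal_biUnion_finset]
  · congr 1
    ext x
    simp [mem_cyl_iff]
  · intro a _ b _ hab
    refine Set.disjoint_left.2 fun x hx hx' ↦ hab ?_
    rw [← mem_cyl_iff.1 hx, ← mem_cyl_iff.1 hx']
  · exact fun s _ ↦ measurableSet_cyl hT hE n s

theorem g0_nonneg {x : ℝ} (h0 : 0 ≤ x) (h1 : x ≤ 1) : 0 ≤ g0 x := by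
  unfold g0
  split_ifs with h
  · rfl
  · refine mul_nonneg h0 (Real.logb_nonneg one_lt_two ?_)
    have := Real.logb_nonpos one_lt_two h0 h1
    linarith

theorem mul_le_g0 {x : ℝ} {L : ℕ} (h0 : 0 ≤ x) (h1 : x < ((2 : ℝ) ^ (2 ^ L))⁻¹) :
    x * L ≤ g0 x := by
  unfold g0
  split_ifs with h
  · simp [h]
  · have hx : 0 < x := lt_of_le_of_ne h0 (Ne.symm h)
    refine mul_le_mul_of_nonneg_left ?_ h0
    have h2 : Real.logb 2 x ≤ -(2 : ℝ) ^ L := by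
      rw [Real.logb_le_iff_le_rpow one_lt_two hx, Real.rpow_neg zero_le_two]
      refine h1.le.trans (le_of_eq ?_)
      congr 1
      exact_mod_cast rfl
    have h3 : (0 : ℝ) < 2 ^ L := by positivity
    rw [Real.le_logb_iff_rpow_le one_lt_two (by linarith), Real.rpow_natCast]
    linarith

/-- Small `g₀`-entropy forces most of the space to be covered by few names. -/
theorem exists_finset_orbitName_of_binEnt_lt {X : Type*} [MeasurableSpace X] {μ : Measure X}
    [IsProbabilityMeasure μ] {T : X → X} (hT : Measurable T) {E : Set X} (hE : MeasurableSet E)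
    {n M : ℕ} (h : binEnt μ T g0 E n < M) :
    ∃ A : Finset (Fin n → Bool), A.card ≤ 2 ^ 2 ^ (4 * M) ∧
      μ.real (orbitName T E n ⁻¹' (A : Set (Fin n → Bool)))ᶜ ≤ 1 / 4 := by
  classical
  set δ : ℝ := ((2 : ℝ) ^ (2 ^ (4 * M)))⁻¹ with hδ
  set A : Finset (Fin n → Bool) := Finset.univ.filter fun s ↦ δ ≤ μ.real (cyl T E n s)
  have hδ0 : 0 < δ := by positivity
  refine ⟨A, ?_, ?_⟩
  · have h1 : (A.card : ℝ) * δ ≤ 1 := by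
      calc (A.card : ℝ) * δ = ∑ s ∈ A, δ := by simp
        _ ≤ ∑ s ∈ A, μ.real (cyl T E n s) :=
          Finset.sum_le_sum fun s hs ↦ (Finset.mem_filter.1 hs).2
        _ = μ.real (orbitName T E n ⁻¹' A) := (measureReal_preimage_orbitName hT hE n A).symm
        _ ≤ 1 := measureReal_le_one
    rw [hδ, ← div_eq_mul_inv, div_le_one (by positivity)] at h1
    exact_mod_cast h1
  · rw [← preimage_compl, ← Finset.coe_compl, measureReal_preimage_orbitName hT hE n]
    have h1 : (∑ s ∈ Aᶜ, μ.real (cyl T E n s)) * (4 * M : ℕ) ≤ binEnt μ T g0 E n := by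
      rw [Finset.sum_mul]
      calc _ ≤ ∑ s ∈ Aᶜ, g0 (μ.real (cyl T E n s)) := by
            refine Finset.sum_le_sum fun s hs ↦ mul_le_g0 measureReal_nonneg ?_
            simpa [A] using hs
        _ ≤ ∑ s, g0 (μ.real (cyl T E n s)) :=
            Finset.sum_le_sum_of_subset_of_nonneg (Finset.subset_univ _)
              fun s _ _ ↦ g0_nonneg measureReal_nonneg measureReal_le_one
        _ = _ := rfl
    have h0 : 0 ≤ binEnt μ T g0 E n :=
      Finset.sum_nonneg fun s _ ↦ g0_nonneg measureReal_nonneg measureReal_le_one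
    have hM : (0 : ℝ) < M := h0.trans_lt h
    push_cast at h1
    by_contra! hc
    nlinarith

theorem measurableSet_setOf_iterate_mem_iff {X : Type*} [MeasurableSpace X] {S : X → X}
    (hS : Measurable S) {E : Set X} (hE : MeasurableSet E) (m : ℕ) :
    MeasurableSet {y | ∀ t < m, (S^[t] y ∈ E ↔ y ∈ E)} := by
  have : {y | ∀ t < m, (S^[t] y ∈ E ↔ y ∈ E)} = ⋂ t, ⋂ _ : t < m, {y | S^[t] y ∈ E ↔ y ∈ E} := by
    ext; simp
  rw [this]
  exact MeasurableSet.iInter fun t ↦ MeasurableSet.iInter fun _ ↦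
    MeasurableSet.iff ((hS.iterate t) hE) hE

/-- If most of the space is covered by few names, then on half of the space the orbit is constant
along a fixed arithmetic progression. -/
theorem half_le_measureReal_of_card_le {X : Type*} [MeasurableSpace X] {μ : Measure X}
    [IsProbabilityMeasure μ] {T : X → X} (hT : MeasurePreserving T μ μ) {E : Set X}
    (hE : MeasurableSet E) {n K m : ℕ} (hK : K ≠ 0) {A : Finset (Fin n → Bool)} (hA : A.card ≤ K)
    (hμ : μ.real (orbitName T E n ⁻¹' (A : Set (Fin n → Bool)))ᶜ ≤ 1 / 4)
    (hm : 2 * K + m * (2 * K).factorial ≤ n) :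
    1 / 2 ≤ μ.real {y | ∀ t < m, ((T^[(2 * K).factorial])^[t] y ∈ E ↔ y ∈ E)} := by
  classical
  set G : Set X := {y | ∀ t < m, ((T^[(2 * K).factorial])^[t] y ∈ E ↔ y ∈ E)} with hG
  have hGm : MeasurableSet G :=
    measurableSet_setOf_iterate_mem_iff (hT.measurable.iterate _) hE _
  set B : Set X := (orbitName T E n ⁻¹' (A : Set (Fin n → Bool)))ᶜ with hB
  have hBm : MeasurableSet B := by
    refine MeasurableSet.compl ?_
    have : orbitName T E n ⁻¹' (A : Set (Fin n → Bool)) = ⋃ s ∈ A, cyl T E n s := by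
      ext x; simp [mem_cyl_iff]
    rw [this]
    exact Finset.measurableSet_biUnion _ fun s _ ↦ measurableSet_cyl hT.measurable hE n s
  set c : X → ℝ := fun x ↦ ∑ i ∈ Finset.range (2 * K), (T^[i] ⁻¹' B).indicator 1 x with hc
  have hBi : ∀ i, MeasurableSet (T^[i] ⁻¹' B) := fun i ↦ (hT.measurable.iterate i) hBm
  have hint : ∫ x, c x ∂μ = 2 * K * μ.real B := by
    rw [hc, integral_finsetSum]
    · rw [Finset.sum_congr rfl (g := fun _ ↦ μ.real B)]
      · simp
      · intro i _
        rw [integral_indicator_one (hBi i), measureReal_def, measureReal_def,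
          (hT.iterate i).measure_preimage hBm.nullMeasurableSet]
    · intro i _
      exact (integrable_const (1 : ℝ)).indicator (hBi i)
  have hmar : K * μ.real {x | (K : ℝ) ≤ c x} ≤ ∫ x, c x ∂μ := by
    refine mul_meas_ge_le_integral_of_nonneg (ae_of_all _ fun x ↦ ?_) ?_ _
    · exact Finset.sum_nonneg fun i _ ↦ indicator_nonneg (fun _ _ ↦ zero_le_one) _
    · exact integrable_finsetSum _ fun i _ ↦ (integrable_const (1 : ℝ)).indicator (hBi i)
  have hK' : (0 : ℝ) < K := by positivity
  have hhalf : μ.real {x | (K : ℝ) ≤ c x} ≤ 1 / 2 := by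
    rw [hint] at hmar
    by_contra! hcon
    nlinarith
  have hsub : {x | (K : ℝ) ≤ c x}ᶜ ⊆ T^[2 * K] ⁻¹' G := by
    intro x hx
    simp only [mem_compl_iff, mem_ofPred_eq, not_le] at hx
    have hcx : c x = ((Finset.range (2 * K)).filter fun i ↦ T^[i] x ∈ B).card := by
      rw [Finset.card_filter]
      simp only [hc, indicator_apply, mem_preimage, Pi.one_apply]
      push_cast
      exact Finset.sum_congr rfl fun i _ ↦ by congr
    rw [hcx] at hx
    have hx' : ((Finset.range (2 * K)).filter fun i ↦ T^[i] x ∈ B).card < K := by exact_mod_cast hx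
    have hadd := Finset.card_filter_add_card_filter_not (s := Finset.range (2 * K))
      (fun i ↦ T^[i] x ∈ B)
    rw [Finset.card_range] at hadd
    obtain ⟨i, hi, j, hj, hij, heq⟩ := Finset.exists_ne_map_eq_of_card_lt_of_maps_to
      (s := (Finset.range (2 * K)).filter fun i ↦ ¬ T^[i] x ∈ B) (t := A)
      (by omega) (f := fun i ↦ orbitName T E n (T^[i] x)) (by
        intro i hi
        simpa [hB] using (Finset.mem_filter.1 hi).2)
    have main : ∀ i j, i < 2 * K → j < 2 * K → i < j →
        orbitName T E n (T^[i] x) = orbitName T E n (T^[j] x) → x ∈ T^[2 * K] ⁻¹' G := by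
      intro i j hi hj hij heq t ht
      obtain ⟨p, rfl⟩ := Nat.exists_eq_add_of_le hij.le
      have hq : p ∣ (2 * K).factorial := Nat.dvd_factorial (by omega) (by omega)
      have := mem_iterate_add_mul_iff_of_name_eq (T := T) (E := E) (n := n) (i := i) (p := p)
        (r := 2 * K) (x := x) (t := t) (fun l hl ↦ ?_) (by omega) hi.le hq (by nlinarith)
      · rw [← Function.iterate_mul, ← Function.iterate_add_apply, add_comm, mul_comm _ t]
        exact this
      · have := congrFun heq ⟨l, hl⟩
        simpa [orbitName] using this
    have hi2 := Finset.mem_range.1 (Finset.mem_filter.1 hi).1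
    have hj2 := Finset.mem_range.1 (Finset.mem_filter.1 hj).1
    rcases lt_or_gt_of_ne hij with hlt | hlt
    · exact main i j hi2 hj2 hlt heq
    · exact main j i hj2 hi2 hlt heq.symm
  have hcm : MeasurableSet {x | (K : ℝ) ≤ c x} := by
    refine measurableSet_le measurable_const ?_
    exact Finset.measurable_sum _ fun i _ ↦ measurable_one.indicator (hBi i)
  have h1 := measureReal_mono (μ := μ) hsub
  rw [probReal_compl_eq_one_sub hcm, measureReal_def (s := T^[2 * K] ⁻¹' G),
    (hT.iterate _).measure_preimage hGm.nullMeasurableSet, ← measureReal_def] at h1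
  linarith

/-- Every sequence of thresholds is dominated by a slowly growing strictly increasing sequence. -/
theorem exists_slow_sequence (N : ℕ → ℕ) :
    ∃ a : ℕ → ℝ, StrictMono a ∧ (∀ n, 0 < a n) ∧
      Tendsto a atTop atTop ∧ Tendsto (fun n => a n / n) atTop (nhds 0) ∧
      ∀ M₀, ∀ᶠ n in atTop, ∃ M ≥ M₀, N M ≤ n ∧ a n ≤ M := by
  classical
  set b : ℕ → ℕ := fun n ↦ Nat.findGreatest (fun M ↦ N M ≤ n) n with hb
  have bmono : Monotone b := by
    intro m n hmn
    exact Nat.findGreatest_mono (fun M hM ↦ le_trans hM hmn) hmn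
  have bge : ∀ M, ∀ᶠ n in atTop, M ≤ b n := by
    intro M
    filter_upwards [eventually_ge_atTop M, eventually_ge_atTop (N M)] with n h1 h2
    exact Nat.le_findGreatest h1 h2
  set d : ℕ → ℝ := fun n ↦ min (b n : ℝ) (Real.sqrt n) with hd
  have dmono : Monotone d := by
    intro m n hmn
    have h1 : (b m : ℝ) ≤ b n := by exact_mod_cast bmono hmn
    have h2 : Real.sqrt m ≤ Real.sqrt n := Real.sqrt_le_sqrt (by exact_mod_cast hmn)
    exact min_le_min h1 h2
  have dnn : ∀ n, 0 ≤ d n := fun n ↦ le_min (by positivity) (Real.sqrt_nonneg _)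
  have b_top : Tendsto (fun n ↦ (b n : ℝ)) atTop atTop :=
    tendsto_natCast_atTop_atTop.comp (tendsto_atTop.2 bge)
  have sqrt_top : Tendsto (fun n : ℕ ↦ Real.sqrt n) atTop atTop :=
    Real.tendsto_sqrt_atTop.comp tendsto_natCast_atTop_atTop
  have d_top : Tendsto d atTop atTop := by
    rw [tendsto_atTop] at b_top sqrt_top ⊢
    intro r
    filter_upwards [b_top r, sqrt_top r] with n h1 h2 using le_min h1 h2
  have einv : ∀ n : ℕ, 1 / ((n : ℝ) + 2) ≤ 1 / 2 := by
    intro n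
    gcongr
    linarith [(Nat.cast_nonneg n : (0 : ℝ) ≤ n)]
  have apos : ∀ n : ℕ, 1 / 2 ≤ d n / 2 + (1 - 1 / ((n : ℝ) + 2)) := by
    intro n
    linarith [dnn n, einv n]
  have ale : ∀ n : ℕ, d n / 2 + (1 - 1 / ((n : ℝ) + 2)) ≤ d n / 2 + 1 := by
    intro n
    have : 0 ≤ 1 / ((n : ℝ) + 2) := by positivity
    linarith
  refine ⟨fun n ↦ d n / 2 + (1 - 1 / ((n : ℝ) + 2)), ?_, ?_, ?_, ?_, ?_⟩
  · intro m n hmn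
    have h1 := dmono hmn.le
    have h2 : 1 / ((n : ℝ) + 2) < 1 / ((m : ℝ) + 2) := by
      have : (m : ℝ) < n := by exact_mod_cast hmn
      gcongr
    simp only
    linarith
  · intro n
    linarith [apos n]
  · refine tendsto_atTop_mono (fun n ↦ ?_) (d_top.atTop_div_const two_pos)
    linarith [einv n]
  · have hlim : Tendsto (fun n : ℕ ↦ 2 * (Real.sqrt n)⁻¹) atTop (nhds 0) := by
      simpa using sqrt_top.inv_tendsto_atTop.const_mul 2
    refine squeeze_zero' ?_ ?_ hlim
    · exact Eventually.of_forall fun n ↦ div_nonneg (by linarith [apos n]) (Nat.cast_nonneg n)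
    · filter_upwards [eventually_ge_atTop 1] with n hn
      have hn' : (1 : ℝ) ≤ n := by exact_mod_cast hn
      have hs : 1 ≤ Real.sqrt n := Real.one_le_sqrt.2 hn'
      have hsq : Real.sqrt n * Real.sqrt n = n := Real.mul_self_sqrt (by linarith)
      rw [div_le_iff₀ (by linarith)]
      have : 2 * (Real.sqrt n)⁻¹ * n = 2 * Real.sqrt n := by
        nth_rw 2 [← hsq]
        field_simp
      rw [this]
      linarith [ale n, min_le_right (b n : ℝ) (Real.sqrt n)]
  · intro M₀
    filter_upwards [bge M₀, bge 2] with n h1 h2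
    refine ⟨b n, h1, ?_, ?_⟩
    · exact Nat.findGreatest_of_ne_zero (P := fun M ↦ N M ≤ n) (m := b n) rfl (by omega)
    · have h2' : (2 : ℝ) ≤ b n := by exact_mod_cast h2
      linarith [ale n, min_le_left (b n : ℝ) (Real.sqrt n)]

/-- For a completely ergodic map of a separable probability space, the times after which the
`g₀`-entropy of `P_n` exceeds `M` are, for large `M`, bounded independently of the binary
partition. -/
theorem exists_le_binEnt_of_le {X : Type*} [MeasurableSpace X] {μ : Measure X}
    [IsProbabilityMeasure μ] [IsSeparable μ] {T : X → X}
    (herg : ∀ n : ℕ, 1 ≤ n → Ergodic (T^[n]) μ) :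
    ∃ N : ℕ → ℕ, ∀ E : Set X, MeasurableSet E → 0 < μ E → μ E < 1 →
      ∃ M₀, ∀ M ≥ M₀, ∀ n ≥ N M, (M : ℝ) ≤ binEnt μ T g0 E n := by
  have hT : MeasurePreserving T μ μ := (herg 1 le_rfl).toMeasurePreserving
  set K : ℕ → ℕ := fun M ↦ 2 ^ 2 ^ (4 * M) with hK
  have herg' : ∀ M, Ergodic (T^[(2 * K M).factorial]) μ :=
    fun M ↦ herg _ (Nat.factorial_pos _)
  have : Fact ((2 : ENNReal) ≠ ⊤) := ⟨ENNReal.ofNat_ne_top⟩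
  obtain ⟨N, hN⟩ := exists_uniform_birkhoffAverage_rate
    (fun M ↦ koopman (herg' M).toMeasurePreserving) (fun M ↦ norm_koopman_le _)
  refine ⟨fun M ↦ 2 * K M + (N M + 1) * (2 * K M).factorial, fun E hE h0 h1 ↦ ?_⟩
  have hc0 : 0 < μ.real E := ENNReal.toReal_pos h0.ne' (measure_ne_top _ _)
  have hc1 : μ.real E < 1 := by
    rw [measureReal_def, ← ENNReal.toReal_one]
    exact (ENNReal.toReal_lt_toReal (measure_ne_top _ _) ENNReal.one_ne_top).2 h1
  have hd : 0 < min (μ.real E) (1 - μ.real E) := lt_min hc0 (by linarith)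
  obtain ⟨M₀, hM₀⟩ := hN (indicatorConstLp 2 hE (measure_ne_top μ E) 1)
    (min (μ.real E) (1 - μ.real E) / 4) (by positivity)
  refine ⟨M₀, fun M hM n hn ↦ ?_⟩
  by_contra! hlt
  obtain ⟨A, hA, hμA⟩ := exists_finset_orbitName_of_binEnt_lt hT.measurable hE hlt
  have hhalf := half_le_measureReal_of_card_le hT hE (K := K M) (by positivity) hA hμA hn
  have hclose := hM₀ M hM (N M + 1) (Nat.le_succ _)
  rw [(herg' M).starProjection_koopman_indicator hE] at hclose
  have hGm : MeasurableSet {y | ∀ t < N M + 1, ((T^[(2 * K M).factorial])^[t] y ∈ E ↔ y ∈ E)} :=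
    measurableSet_setOf_iterate_mem_iff (hT.measurable.iterate _) hE _
  have hfar := measure_mul_min_le_norm_birkhoffAverage_sub (herg' M).toMeasurePreserving hE hGm
    (Nat.succ_ne_zero (N M)) (fun y hy ↦ hy)
  nlinarith

/-- For every invertible, completely ergodic measure-preserving transformation `T` of the
unit interval with Lebesgue measure, there exists an increasing sequence `(aₙ)` of positive
reals with `aₙ → ∞`, `aₙ/n → 0`, such that every nontrivial binary partition `{E, Eᶜ}`
satisfies `liminf H(g₀, Pₙ)/aₙ ≥ 1`. -/
theorem statement0 (T : Set.Icc (0:ℝ) 1 → Set.Icc (0:ℝ) 1)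
    (hT : MeasurePreserving T volume volume)
    (hinv : ∃ S : Set.Icc (0:ℝ) 1 → Set.Icc (0:ℝ) 1,
      Measurable S ∧ Function.LeftInverse S T ∧ Function.RightInverse S T)
    (herg : ∀ n : ℕ, 1 ≤ n → Ergodic (T^[n]) volume) :
    ∃ a : ℕ → ℝ, StrictMono a ∧ (∀ n, 0 < a n) ∧
      Tendsto a atTop atTop ∧ Tendsto (fun n => a n / n) atTop (nhds 0) ∧
      ∀ E : Set (Set.Icc (0:ℝ) 1), MeasurableSet E → 0 < volume E → volume E < 1 →
        (1 : EReal) ≤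
          Filter.liminf (fun n => ((binEnt volume T g0 E n / a n : ℝ) : EReal)) atTop := by
  have : IsProbabilityMeasure (volume : Measure (Set.Icc (0:ℝ) 1)) :=
    inferInstanceAs (IsProbabilityMeasure (volume : Measure unitInterval))
  obtain ⟨N, hN⟩ := exists_le_binEnt_of_le herg
  obtain ⟨a, ha, ha0, hat, han, haN⟩ := exists_slow_sequence N
  refine ⟨a, ha, ha0, hat, han, fun E hE h0 h1 ↦ ?_⟩
  obtain ⟨M₀, hM₀⟩ := hN E hE h0 h1
  refine le_liminf_of_le (by isBoundedDefault) ?_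
  filter_upwards [haN M₀] with n ⟨M, hM, hn, hle⟩
  have h : 1 ≤ binEnt volume T g0 E n / a n := by
    rw [one_le_div (ha0 n)]
    exact hle.trans (hM₀ M hM n hn)
  exact_mod_cast h
end

section
/- Let (X,Σ,μ) be a standard (Lebesgue) probability space and T an invertible measure-preserving transformation of X that is aperiodic, i.e. μ({x ∈ X : T^n x = x for some n ≥ 1}) = 0. Let g:[0,1]→ℝ be concave with g(0) = lim_{x→0⁺} g(x) = 0 and 0 < lim_{x→0⁺} g(x)/η(x) < ∞, where η(x) = −x log₂ x. Let (a_n) be a strictly increasing sequence of positive reals with a_n → ∞ and a_n/n → 0. Then there exists a measurable set E ⊆ X with 0 < μ(E) < 1 such that the binary partition P^E = {E, X∖E} satisfies lim_{n→∞} H(g, P_n^E)/a_n = ∞. -/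
open MeasureTheory Filter Set

/-- The Shannon function `η(x) = −x·log₂ x`. -/
noncomputable def shannonF : ℝ → ℝ := fun x => -(x * Real.logb 2 x)

namespace PartitionEntropy

open Real

/-- Gibbs' inequality for a single pair of weights. -/
lemma negMulLog_le_of_pos {p t : ℝ} (hp : 0 ≤ p) (ht : 0 ≤ t) (hpt : 0 < p → 0 < t) :
    negMulLog p ≤ -p * log t + (t - p) := by
  rcases hp.eq_or_lt with rfl | hp
  · simpa using ht
  · have ht' := hpt hp
    have h := log_le_sub_one_of_pos (div_pos ht' hp)
    rw [log_div ht'.ne' hp.ne'] at h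
    have h2 : p * (log t - log p) ≤ p * (t / p - 1) := mul_le_mul_of_nonneg_left h hp.le
    have h3 : p * (t / p - 1) = t - p := by field_simp
    rw [negMulLog]
    nlinarith

lemma negMulLog_sum_le {ι : Type*} {s : Finset ι} {p : ι → ℝ} (hp : ∀ i, 0 ≤ p i) :
    negMulLog (∑ i ∈ s, p i) ≤ ∑ i ∈ s, negMulLog (p i) := by
  rw [negMulLog, ← Finset.sum_neg_distrib, Finset.sum_mul]
  refine Finset.sum_le_sum fun i hi => ?_
  rcases (hp i).eq_or_lt with h | h
  · simp [← h]
  · have := log_le_log h (Finset.single_le_sum (fun j _ => hp j) hi)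
    rw [negMulLog]
    nlinarith

/-- Entropy, in nats, of the partition into the fibres of a map with finitely many values. -/
noncomputable def fibreEntropy {X ι : Type*} [MeasurableSpace X] [Fintype ι] (μ : Measure X)
    (f : X → ι) : ℝ :=
  ∑ i, negMulLog (μ.real (f ⁻¹' {i}))

section Entropy

variable {X ι κ : Type*} [MeasurableSpace X] [Fintype ι] [Fintype κ]
  {μ : Measure X}

lemma fibreEntropy_nonneg [IsProbabilityMeasure μ] (f : X → ι) : 0 ≤ fibreEntropy μ f :=
  Finset.sum_nonneg fun _ _ => negMulLog_nonneg measureReal_nonneg measureReal_le_one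

lemma fibreEntropy_comp_le [MeasurableSpace κ] [MeasurableSingletonClass κ] {k : X → κ}
    [IsFiniteMeasure μ]
    (hk : Measurable k) (φ : κ → ι) :
    fibreEntropy μ (fun x => φ (k x)) ≤ fibreEntropy μ k := by
  classical
  rw [fibreEntropy, fibreEntropy, ← Finset.sum_fiberwise Finset.univ φ]
  refine Finset.sum_le_sum fun i _ => ?_
  have h : μ.real ((fun x => φ (k x)) ⁻¹' {i}) =
      ∑ j ∈ Finset.univ.filter (φ · = i), μ.real (k ⁻¹' {j}) := by
    rw [sum_measureReal_preimage_singleton _ fun j _ => hk (measurableSet_singleton j)]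
    congr 1
    ext x
    simp
  rw [h]
  exact negMulLog_sum_le fun _ => measureReal_nonneg

variable [MeasurableSpace ι] [MeasurableSingletonClass ι] [MeasurableSpace κ]
  [MeasurableSingletonClass κ]

lemma fibreEntropy_comp_measurePreserving {f : X → ι} (hf : Measurable f) {T : X → X}
    (hT : MeasurePreserving T μ μ) : fibreEntropy μ (fun x => f (T x)) = fibreEntropy μ f :=
  Finset.sum_congr rfl fun i _ => by
    rw [← hT.measureReal_preimage (hf (measurableSet_singleton i)).nullMeasurableSet]
    rfl

variable [IsProbabilityMeasure μ]

lemma sum_real_fibre {f : X → ι} (hf : Measurable f) : ∑ i, μ.real (f ⁻¹' {i}) = 1 := by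
  rw [sum_measureReal_preimage_singleton _ fun i _ => hf (measurableSet_singleton i)]
  simp

lemma sum_real_fibre_inter {f : X → ι} (hf : Measurable f) (F : Set X) :
    ∑ i, μ.real (f ⁻¹' {i} ∩ F) = μ.real F := by
  have h := sum_measureReal_preimage_singleton (μ := μ.restrict F) Finset.univ
    (f := f) fun i _ => hf (measurableSet_singleton i)
  simp only [Finset.coe_univ, preimage_univ] at h
  rw [measureReal_restrict_apply MeasurableSet.univ, univ_inter] at h
  rw [← h]
  exact Finset.sum_congr rfl fun i _ =>
    (measureReal_restrict_apply (hf (measurableSet_singleton i))).symm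

lemma fibreEntropy_prodMk_le {f : X → ι} {k : X → κ} (hf : Measurable f) (hk : Measurable k) :
    fibreEntropy μ (fun x => (f x, k x)) ≤ fibreEntropy μ f + fibreEntropy μ k := by
  set P : ι → ℝ := fun i => μ.real (f ⁻¹' {i}) with hP
  set Q : κ → ℝ := fun j => μ.real (k ⁻¹' {j}) with hQ
  set R : ι × κ → ℝ := fun z => μ.real ((fun x => (f x, k x)) ⁻¹' {z}) with hR
  have hRe : ∀ i j, R (i, j) = μ.real (k ⁻¹' {j} ∩ f ⁻¹' {i}) := by
    intro i j
    simp only [hR]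
    congr 1
    ext x
    simp [and_comm]
  have hR1 : ∀ i, ∑ j, R (i, j) = P i := fun i => by
    simp only [hRe]
    exact sum_real_fibre_inter hk _
  have hR2 : ∀ j, ∑ i, R (i, j) = Q j := fun j => by
    simp only [hRe, inter_comm (k ⁻¹' {j})]
    exact sum_real_fibre_inter hf _
  have hRP : ∀ i j, R (i, j) ≤ P i := fun i j => by
    rw [hRe]; exact measureReal_mono inter_subset_right
  have hRQ : ∀ i j, R (i, j) ≤ Q j := fun i j => by
    rw [hRe]; exact measureReal_mono inter_subset_left
  have key : ∀ i j, negMulLog (R (i, j)) ≤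
      -R (i, j) * log (P i) + -R (i, j) * log (Q j) + (P i * Q j - R (i, j)) := by
    intro i j
    have h := negMulLog_le_of_pos (p := R (i, j)) (t := P i * Q j) measureReal_nonneg
      (mul_nonneg measureReal_nonneg measureReal_nonneg)
      fun h => mul_pos (h.trans_le (hRP i j)) (h.trans_le (hRQ i j))
    have hR0 : 0 ≤ R (i, j) := measureReal_nonneg
    rcases hR0.eq_or_lt with h0 | h0
    · rw [← h0] at h ⊢
      simpa using h
    · rw [log_mul (h0.trans_le (hRP i j)).ne' (h0.trans_le (hRQ i j)).ne'] at h
      linarith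
  have s1 : ∑ i, ∑ j, -R (i, j) * log (P i) = fibreEntropy μ f :=
    Finset.sum_congr rfl fun i _ => by
      rw [← Finset.sum_mul, Finset.sum_neg_distrib, hR1, negMulLog]
  have s2 : ∑ i, ∑ j, -R (i, j) * log (Q j) = fibreEntropy μ k := by
    rw [Finset.sum_comm]
    exact Finset.sum_congr rfl fun j _ => by
      rw [← Finset.sum_mul, Finset.sum_neg_distrib, hR2, negMulLog]
  have s3 : ∑ i, ∑ j, (P i * Q j - R (i, j)) = 0 := by
    simp only [Finset.sum_sub_distrib, ← Finset.mul_sum, hR1]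
    simp only [hQ, sum_real_fibre hk, mul_one, sub_self]
  calc fibreEntropy μ (fun x => (f x, k x)) = ∑ i, ∑ j, negMulLog (R (i, j)) :=
        Fintype.sum_prod_type _
    _ ≤ ∑ i, ∑ j, (-R (i, j) * log (P i) + -R (i, j) * log (Q j) + (P i * Q j - R (i, j))) :=
        Finset.sum_le_sum fun i _ => Finset.sum_le_sum fun j _ => key i j
    _ = fibreEntropy μ f + fibreEntropy μ k := by
        simp only [Finset.sum_add_distrib, s1, s2, s3, add_zero]

/-- If every fibre meets `F` in relative measure at most `exp (-t)`, the entropy is at least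
`μ F * t`. -/
lemma mul_le_fibreEntropy {f : X → ι} (hf : Measurable f) {F : Set X} (hF : MeasurableSet F)
    {t : ℝ} (h : ∀ i, μ.real (f ⁻¹' {i} ∩ F) ≤ μ.real F * exp (-t)) :
    μ.real F * t ≤ fibreEntropy μ f := by
  set l := μ.real F with hl
  have hl0 : 0 ≤ l := measureReal_nonneg
  rcases hl0.eq_or_lt with h0 | h0
  · rw [← h0, zero_mul]; exact fibreEntropy_nonneg f
  have hl1 : l ≤ 1 := measureReal_le_one
  calc l * t = ∑ i, μ.real (f ⁻¹' {i} ∩ F) * t := by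
        rw [← Finset.sum_mul, sum_real_fibre_inter hf F]
    _ ≤ fibreEntropy μ f := Finset.sum_le_sum fun i _ => ?_
  set q := μ.real (f ⁻¹' {i} ∩ F) with hq
  set r := μ.real (f ⁻¹' {i} \ F) with hr
  have hqr : μ.real (f ⁻¹' {i}) = q + r := (measureReal_inter_add_sdiff hF).symm
  have hq0 : 0 ≤ q := measureReal_nonneg
  have hr0 : 0 ≤ r := measureReal_nonneg
  have hr1 : r ≤ 1 - l := by
    rw [hl, ← probReal_compl_eq_one_sub hF]
    exact measureReal_mono (sdiff_subset_compl _ _)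
  have hv1 : r / (1 - l) ≤ 1 := div_le_one_of_le₀ hr1 (by linarith)
  have hv0 : 0 ≤ r / (1 - l) := div_nonneg hr0 (by linarith)
  have hrv : (1 - l) * (r / (1 - l)) = r := by
    rcases eq_or_ne (1 - l) 0 with hz | hz
    · rw [hz] at hr1 ⊢; linarith
    · field_simp
  have hlu : l * (q / l) = q := mul_div_cancel₀ q h0.ne'
  have hc := concaveOn_negMulLog.2 (x := q / l) (y := r / (1 - l)) (mem_Ici.2 (by positivity))
    (mem_Ici.2 hv0) h0.le (by linarith : 0 ≤ 1 - l) (by ring)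
  simp only [smul_eq_mul, hrv, hlu] at hc
  rw [hqr]
  refine le_trans ?_ hc
  have hv := mul_nonneg (by linarith : 0 ≤ 1 - l) (negMulLog_nonneg hv0 hv1)
  have hu : q / l * t ≤ negMulLog (q / l) := by
    rcases hq0.eq_or_lt with hz | hz
    · simp [← hz]
    · have hpos : 0 < q / l := div_pos hz h0
      have : log (q / l) ≤ -t := by
        rw [log_le_iff_le_exp hpos, div_le_iff₀' h0]; exact h i
      rw [negMulLog]
      nlinarith
  have := mul_le_mul_of_nonneg_left hu h0.le
  rw [← mul_assoc, hlu] at this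
  linarith

end Entropy

section Names

variable {X : Type*} {T : X → X} {E D : Set X}

open Classical in
/-- The `n`-name of a point with respect to the binary partition `{E, Eᶜ}`. -/
noncomputable def itinerary {X : Type*} (T : X → X) (E : Set X) (n : ℕ) (x : X) : Fin n → Bool :=
  fun i => decide (T^[(i : ℕ)] x ∈ E)

lemma itinerary_preimage_singleton (n : ℕ) (s : Fin n → Bool) :
    itinerary T E n ⁻¹' {s} = cyl T E n s := by
  ext x
  simp only [cyl, itinerary, mem_preimage, mem_singleton_iff, mem_ofPred_eq, funext_iff]
  exact forall_congr' fun i => by cases s i <;> simp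

variable [MeasurableSpace X] {μ : Measure X}

lemma measurable_itinerary (hT : Measurable T) (hE : MeasurableSet E) (n : ℕ) :
    Measurable (itinerary T E n) := by
  refine measurable_pi_iff.2 fun i => measurable_to_bool ?_
  have : (fun x => itinerary T E n x i) ⁻¹' {true} = T^[(i : ℕ)] ⁻¹' E := by
    ext x
    simp [itinerary]
  rw [this]
  exact hT.iterate _ hE

variable [IsProbabilityMeasure μ]

lemma subadditive_fibreEntropy_itinerary (hT : MeasurePreserving T μ μ) (hE : MeasurableSet E) :
    Subadditive fun n => fibreEntropy μ (itinerary T E n) := by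
  intro m n
  have hm := measurable_itinerary hT.measurable hE m
  have hn := measurable_itinerary hT.measurable hE n
  have h1 := fibreEntropy_comp_measurePreserving hn (hT.iterate m)
  have h2 := fibreEntropy_prodMk_le (μ := μ) hm (hn.comp (hT.measurable.iterate m))
  have h3 := fibreEntropy_comp_le (μ := μ) (hm.prodMk (hn.comp (hT.measurable.iterate m)))
    fun z => Fin.append z.1 z.2
  have h4 : (fun x => Fin.append (itinerary T E m x) ((itinerary T E n ∘ T^[m]) x)) =
      itinerary T E (m + n) := by
    funext x i
    refine Fin.addCases (fun j => ?_) (fun j => ?_) i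
    · simp [itinerary]
    · simp [itinerary, add_comm m, Function.iterate_add_apply]
  simp only [h4] at h3
  simp only [Function.comp_def] at h2 h3
  linarith

lemma fibreEntropy_itinerary_mono (hT : MeasurePreserving T μ μ) (hE : MeasurableSet E)
    {m n : ℕ} (h : m ≤ n) :
    fibreEntropy μ (itinerary T E m) ≤ fibreEntropy μ (itinerary T E n) :=
  fibreEntropy_comp_le (measurable_itinerary hT.measurable hE n)
    fun s (i : Fin m) => s (Fin.castLE h i)

/-- The entropy rate up to time `n` is at least half of the rate up to a later time `N`. -/
lemma fibreEntropy_itinerary_rate (hT : MeasurePreserving T μ μ) (hE : MeasurableSet E)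
    {n N : ℕ} (h : n ≤ N) :
    n * fibreEntropy μ (itinerary T E N) ≤ 2 * N * fibreEntropy μ (itinerary T E n) := by
  rcases n.eq_zero_or_pos with rfl | hn
  · have := fibreEntropy_nonneg (μ := μ) (itinerary T E 0)
    simp only [Nat.cast_zero, zero_mul]
    positivity
  have h1 := (subadditive_fibreEntropy_itinerary hT hE).apply_mul_add_le (N / n) n (N % n)
  have h2 := fibreEntropy_itinerary_mono hT hE (Nat.mod_lt N hn).le
  have h0 := fibreEntropy_nonneg (μ := μ) (itinerary T E n)
  rw [mul_comm (N / n) n, Nat.div_add_mod] at h1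
  have h3 : fibreEntropy μ (itinerary T E N) ≤
      ((N / n : ℕ) + 1) * fibreEntropy μ (itinerary T E n) := by linarith
  have h4 : (n : ℝ) * ((N / n : ℕ) + 1) ≤ 2 * N := by
    have : n * (N / n + 1) ≤ 2 * N := by
      have := Nat.mul_div_le N n
      rw [mul_add]; omega
    exact_mod_cast this
  calc (n : ℝ) * fibreEntropy μ (itinerary T E N)
      ≤ n * (((N / n : ℕ) + 1) * fibreEntropy μ (itinerary T E n)) := by gcongr
    _ = n * ((N / n : ℕ) + 1) * fibreEntropy μ (itinerary T E n) := by ring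
    _ ≤ _ := by gcongr

lemma fibreEntropy_itinerary_one (hD : MeasurableSet D) :
    fibreEntropy μ (itinerary T D 1) = binEntropy (μ.real D) := by
  rw [binEntropy_eq_negMulLog_add_negMulLog_one_sub, fibreEntropy,
    ← (Equiv.funUnique (Fin 1) Bool).symm.sum_comp, Fintype.sum_bool,
    ← probReal_compl_eq_one_sub hD]
  congr 3
  · rw [itinerary_preimage_singleton]; ext x; simp [cyl]
  · rw [itinerary_preimage_singleton]; ext x; simp [cyl]

lemma fibreEntropy_itinerary_le (hT : MeasurePreserving T μ μ) (hD : MeasurableSet D) (n : ℕ) :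
    fibreEntropy μ (itinerary T D n) ≤ n * binEntropy (μ.real D) := by
  have h := (subadditive_fibreEntropy_itinerary hT hD).apply_mul_add_le n 1 0
  have h0 : fibreEntropy μ (itinerary T D 0) = 0 := by
    have he : ∀ s, cyl T D 0 s = univ := fun s => by ext x; simp [cyl]
    simp only [fibreEntropy, itinerary_preimage_singleton, he]
    simp
  rwa [h0, fibreEntropy_itinerary_one hD, mul_one, add_zero, add_zero] at h

/-- Entropy is stable under small modifications of the set, uniformly in the rate. -/
lemma fibreEntropy_itinerary_le_add (hT : MeasurePreserving T μ μ) (hE : MeasurableSet E)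
    (hD : MeasurableSet D) (n : ℕ) :
    fibreEntropy μ (itinerary T E n) ≤
      fibreEntropy μ (itinerary T D n) + n * binEntropy (μ.real (symmDiff E D)) := by
  have hED : MeasurableSet (symmDiff E D) := hE.symmDiff hD
  have m1 := measurable_itinerary hT.measurable hD n
  have m2 := measurable_itinerary hT.measurable hED n
  have h1 := fibreEntropy_prodMk_le (μ := μ) m1 m2
  have h2 := fibreEntropy_itinerary_le hT hED n
  have h3 := fibreEntropy_comp_le (μ := μ) (m1.prodMk m2) fun z i => xor (z.1 i) (z.2 i)
  have h4 : (fun x i => xor (itinerary T D n x i) (itinerary T (symmDiff E D) n x i)) =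
      itinerary T E n := by
    funext x i
    have hs := mem_symmDiff (a := T^[(i : ℕ)] x) (s := E) (t := D)
    simp only [itinerary]
    by_cases a : T^[(i : ℕ)] x ∈ E <;> by_cases b : T^[(i : ℕ)] x ∈ D <;> simp [a, b, hs]
  simp only [h4] at h3
  linarith

end Names

section Splitting

variable {X : Type*} [MeasurableSpace X] {μ : Measure X}

lemma exists_measurableSet_half [StandardBorelSpace X] [IsFiniteMeasure μ]
    (h : ∀ x, μ {x} = 0) {C : Set X} (hC : MeasurableSet C) :
    ∃ D ⊆ C, MeasurableSet D ∧ μ.real D = μ.real C / 2 := by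
  by_cases h0 : μ C = 0
  · exact ⟨∅, empty_subset _, MeasurableSet.empty, by simp [measureReal_def, h0]⟩
  have := ProbabilityTheory.cond_isProbabilityMeasure h0
  set u := embeddingReal X
  have hu : MeasurableEmbedding u := measurableEmbedding_embeddingReal X
  set ν := (ProbabilityTheory.cond μ C).map u with hν
  have hνp : IsProbabilityMeasure ν := Measure.isProbabilityMeasure_map hu.measurable.aemeasurable
  have hν0 : ∀ t, ν {t} = 0 := fun t => by
    rw [hν, hu.map_apply]
    refine ProbabilityTheory.cond_absolutelyContinuous ?_
    rcases (subsingleton_singleton.preimage hu.injective (s := {t})).eq_empty_or_singleton with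
      he | ⟨x, hx⟩
    · simp [he]
    · rw [hx, h]
  have hcont : Continuous (ProbabilityTheory.cdf ν) := by
    refine continuous_iff_continuousAt.2 fun t => ?_
    rw [(ProbabilityTheory.monotone_cdf ν).continuousAt_iff_leftLim_eq_rightLim,
      StieltjesFunction.rightLim_eq]
    have h1 := hν0 t
    rw [← ProbabilityTheory.measure_cdf ν, StieltjesFunction.measure_singleton,
      ENNReal.ofReal_eq_zero] at h1
    exact le_antisymm ((ProbabilityTheory.monotone_cdf ν).leftLim_le le_rfl) (by linarith)
  obtain ⟨t, ht⟩ : (1 / 2 : ℝ) ∈ range (ProbabilityTheory.cdf ν) := by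
    refine mem_range_of_exists_le_of_exists_ge hcont ?_ ?_
    · exact ((ProbabilityTheory.tendsto_cdf_atBot ν).eventually_le_const (by norm_num)).exists
    · exact ((ProbabilityTheory.tendsto_cdf_atTop ν).eventually_const_le (by norm_num)).exists
  refine ⟨C ∩ u ⁻¹' Iic t, inter_subset_left, hC.inter (hu.measurable measurableSet_Iic), ?_⟩
  rw [ProbabilityTheory.cdf_eq_real, measureReal_def, hν, hu.map_apply,
    ProbabilityTheory.cond_apply hC, ENNReal.toReal_mul, ENNReal.toReal_inv] at ht
  have hpos : 0 < (μ C).toReal := ENNReal.toReal_pos h0 (measure_ne_top _ _)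
  rw [measureReal_def, measureReal_def]
  field_simp at ht
  linarith

/-- In a non-atomic space, every measurable set can be coded by `2 ^ m` equidistributed
labels. -/
lemma exists_equidistributed_code [StandardBorelSpace X] [IsFiniteMeasure μ]
    (h : ∀ x, μ {x} = 0) (m : ℕ) : ∀ {C : Set X}, MeasurableSet C →
    ∃ c : X → (Fin m → Bool), Measurable c ∧ ∀ v, μ.real (C ∩ c ⁻¹' {v}) ≤ μ.real C / 2 ^ m := by
  classical
  induction m with
  | zero =>
    refine fun {C} hC => ⟨fun _ => default, measurable_const, fun v => ?_⟩
    simpa using measureReal_mono (μ := μ) (inter_subset_left (s := C))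
  | succ m ih =>
    intro C hC
    obtain ⟨D, hDC, hD, hμ⟩ := exists_measurableSet_half h hC
    obtain ⟨c₁, hc₁, h₁⟩ := ih hD
    obtain ⟨c₂, hc₂, h₂⟩ := ih (hC.diff hD)
    have hμ' : μ.real (C \ D) = μ.real C / 2 := by
      rw [measureReal_sdiff hDC hD, hμ]; ring
    refine ⟨fun x => if x ∈ D then Fin.cons true (c₁ x) else Fin.cons false (c₂ x), ?_, ?_⟩
    · refine Measurable.ite hD ?_ ?_
      · exact (measurable_of_finite fun w : Fin m → Bool =>
          (Fin.cons true w : Fin (m + 1) → Bool)).comp hc₁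
      · exact (measurable_of_finite fun w : Fin m → Bool =>
          (Fin.cons false w : Fin (m + 1) → Bool)).comp hc₂
    · intro v
      have e : μ.real C / 2 ^ (m + 1) = μ.real C / 2 / 2 ^ m := by rw [pow_succ]; field_simp
      rw [e]
      cases hv : v 0 with
      | true =>
        rw [← hμ]
        refine le_trans (measureReal_mono ?_) (h₁ (Fin.tail v))
        rintro x ⟨hx, rfl⟩
        by_cases hxD : x ∈ D
        · simp [hxD]
        · simp [hxD] at hv
      | false =>
        rw [← hμ']
        refine le_trans (measureReal_mono ?_) (h₂ (Fin.tail v))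
        rintro x ⟨hx, rfl⟩
        by_cases hxD : x ∈ D
        · simp [hxD] at hv
        · simp [hxD, hx]

end Splitting

section Towers

variable {X : Type*} {T S : X → X}

/-- The points which lie within `M` steps of `B` along their orbit. -/
def orbitNhd (T S : X → X) (M : ℕ) (B : Set X) : Set X :=
  ⋃ i ∈ Finset.range M, (T^[i] ⁻¹' B ∪ S^[i] ⁻¹' B)

lemma mem_orbitNhd {M : ℕ} {B : Set X} {x : X} :
    x ∈ orbitNhd T S M B ↔ ∃ i < M, T^[i] x ∈ B ∨ S^[i] x ∈ B := by
  simp [orbitNhd]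

variable [MeasurableSpace X] {μ : Measure X}

lemma measure_singleton_eq_zero_of_aperiodic [MeasurableSingletonClass X] [IsFiniteMeasure μ]
    (hT : MeasurePreserving T μ μ) (haper : μ {x | ∃ n : ℕ, 1 ≤ n ∧ T^[n] x = x} = 0) (x : X) :
    μ {x} = 0 := by
  by_contra h
  obtain ⟨y, rfl, n, hn, hy⟩ := hT.conservative.exists_mem_iterate_mem
    (measurableSet_singleton x).nullMeasurableSet h
  refine h (measure_mono_null ?_ haper)
  rintro _ rfl
  exact ⟨n, Nat.one_le_iff_ne_zero.2 hn, hy⟩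

lemma measurableSet_orbitNhd (hT : Measurable T) (hS : Measurable S) (M : ℕ) {B : Set X}
    (hB : MeasurableSet B) : MeasurableSet (orbitNhd T S M B) :=
  Finset.measurableSet_biUnion _ fun i _ => (hT.iterate i hB).union (hS.iterate i hB)

/-- A maximal set which is disjoint from its first `M - 1` preimages, built greedily. -/
lemma exists_disjoint_iterates_cover (hT : Measurable T) (hS : Measurable S)
    (hST : Function.LeftInverse S T) {M : ℕ} (hM : 0 < M) (A : ℕ → Set X)
    (hA : ∀ k, MeasurableSet (A k))
    (hAT : ∀ k, ∀ x ∈ A k, ∀ i, 1 ≤ i → i < M → T^[i] x ∉ A k) :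
    ∃ B, MeasurableSet B ∧ (∀ x ∈ B, ∀ i, 1 ≤ i → i < M → T^[i] x ∉ B) ∧
      ∀ k, A k ⊆ orbitNhd T S M B := by
  let B : ℕ → Set X := fun k => Nat.rec ∅ (fun k B => B ∪ (A k \ orbitNhd T S M B)) k
  have hBs : ∀ k, B (k + 1) = B k ∪ (A k \ orbitNhd T S M (B k)) := fun k => rfl
  have hBm : ∀ k, MeasurableSet (B k) := fun k => by
    induction k with
    | zero => exact MeasurableSet.empty
    | succ k ih =>
      rw [hBs]
      exact ih.union ((hA k).diff (measurableSet_orbitNhd hT hS M ih))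
  have hmono : Monotone B := monotone_nat_of_le_succ fun k => by
    rw [hBs]; exact subset_union_left
  have hBT : ∀ k, ∀ x ∈ B k, ∀ i, 1 ≤ i → i < M → T^[i] x ∉ B k := fun k => by
    induction k with
    | zero => exact fun x hx => absurd hx (notMem_empty x)
    | succ k ih =>
      rw [hBs]
      rintro x (hx | ⟨hx, hx'⟩) i h1 hi (hy | ⟨hy, hy'⟩)
      · exact ih x hx i h1 hi hy
      · exact hy' (mem_orbitNhd.2 ⟨i, hi, Or.inr (by rwa [hST.iterate i x])⟩)
      · exact hx' (mem_orbitNhd.2 ⟨i, hi, Or.inl hy⟩)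
      · exact hAT k x hx i h1 hi hy
  refine ⟨⋃ k, B k, MeasurableSet.iUnion hBm, ?_, fun k x hx => ?_⟩
  · intro x hx i h1 hi hy
    obtain ⟨k, hk⟩ := mem_iUnion.1 hx
    obtain ⟨l, hl⟩ := mem_iUnion.1 hy
    exact hBT (max k l) x (hmono (le_max_left k l) hk) i h1 hi (hmono (le_max_right k l) hl)
  · by_cases h : x ∈ orbitNhd T S M (B k)
    · obtain ⟨i, hi, h⟩ := mem_orbitNhd.1 h
      exact mem_orbitNhd.2 ⟨i, hi, h.imp (mem_iUnion_of_mem k) (mem_iUnion_of_mem k)⟩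
    · exact mem_orbitNhd.2 ⟨0, hM, Or.inl (mem_iUnion_of_mem (k + 1) (Or.inr ⟨hx, h⟩))⟩

/-- Aperiodic points are covered by countably many sets disjoint from their first preimages. -/
lemma exists_cover_disjoint_iterates [StandardBorelSpace X] [Nonempty X] (hT : Measurable T)
    (M : ℕ) : ∃ A : ℕ → Set X, (∀ k, MeasurableSet (A k)) ∧
      (∀ k, ∀ x ∈ A k, ∀ i, 1 ≤ i → i < M → T^[i] x ∉ A k) ∧
      ∀ x, (∀ n, 1 ≤ n → T^[n] x ≠ x) → ∃ k, x ∈ A k := by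
  let := upgradeStandardBorel X
  obtain ⟨V₀, hV₀, -⟩ := (TopologicalSpace.isBasis_countableBasis X).exists_subset_of_mem_open
    (mem_univ (Classical.arbitrary X)) isOpen_univ
  obtain ⟨U, hU⟩ := (TopologicalSpace.countable_countableBasis X).exists_eq_range ⟨V₀, hV₀⟩
  refine ⟨fun k => U k ∩ ⋂ i ∈ Finset.Ico 1 M, T^[i] ⁻¹' (U k)ᶜ, fun k => ?_, ?_, fun x hx => ?_⟩
  · have hUk : MeasurableSet (U k) := (TopologicalSpace.isOpen_of_mem_countableBasis
      (hU ▸ mem_range_self k)).measurableSet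
    exact hUk.inter (Finset.measurableSet_biInter _ fun i _ => hT.iterate i hUk.compl)
  · rintro k x ⟨-, hx⟩ i h1 hi ⟨hy, -⟩
    exact mem_iInter₂.1 hx i (Finset.mem_Ico.2 ⟨h1, hi⟩) hy
  · set F : Set X := (fun i => T^[i] x) '' (Finset.Ico 1 M : Finset ℕ) with hF
    have hFf : F.Finite := (Finset.finite_toSet _).image _
    have hxF : x ∈ Fᶜ := by
      rintro ⟨i, hi, h⟩
      exact hx i (Finset.mem_Ico.1 hi).1 h
    obtain ⟨V, hV, hxV, hVF⟩ := (TopologicalSpace.isBasis_countableBasis X).exists_subset_of_mem_open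
      hxF hFf.isClosed.isOpen_compl
    rw [hU] at hV
    obtain ⟨k, rfl⟩ := hV
    exact ⟨k, hxV, mem_iInter₂.2 fun i hi h => hVF h ⟨i, hi, rfl⟩⟩

/-- A weak form of Rokhlin's lemma: there are towers of any height filling half of the space. -/
lemma exists_tower [StandardBorelSpace X] [IsProbabilityMeasure μ] (hT : MeasurePreserving T μ μ)
    (hS : Measurable S) (hST : Function.LeftInverse S T)
    (haper : μ {x | ∃ n : ℕ, 1 ≤ n ∧ T^[n] x = x} = 0) {M : ℕ} (hM : 0 < M) :
    ∃ C, MeasurableSet C ∧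
      (∀ i < M, ∀ j < M, ∀ x, T^[i] x ∈ C → T^[j] x ∈ C → i = j) ∧
      1 ≤ 2 * M * μ.real C := by
  have : Nonempty X := μ.nonempty_of_neZero
  obtain ⟨A, hA, hAT, hcov⟩ := exists_cover_disjoint_iterates hT.measurable M
  obtain ⟨B, hB, hBT, hBA⟩ := exists_disjoint_iterates_cover hT.measurable hS hST hM A hA hAT
  have hlt : ∀ i j, i < j → j < M → ∀ x, T^[i] x ∈ B → T^[j] x ∉ B := fun i j hij hj x hi h => by
    refine hBT _ hi (j - i) (by omega) (by omega) ?_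
    rwa [← Function.iterate_add_apply, Nat.sub_add_cancel hij.le]
  refine ⟨B, hB, fun i hi j hj x h1 h2 => ?_, ?_⟩
  · rcases lt_trichotomy i j with h | h | h
    · exact absurd h2 (hlt i j h hj x h1)
    · exact h
    · exact absurd h1 (hlt j i h hi x h2)
  have hSB : ∀ i, μ.real (S^[i] ⁻¹' B) = μ.real B := fun i => by
    rw [← (hT.iterate i).measureReal_preimage (hS.iterate i hB).nullMeasurableSet]
    congr 1
    ext x
    simp [hST.iterate i x]
  have hTB : ∀ i, μ.real (T^[i] ⁻¹' B) = μ.real B := fun i =>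
    (hT.iterate i).measureReal_preimage hB.nullMeasurableSet
  have hfull : μ.real (orbitNhd T S M B) = 1 := by
    have : μ (orbitNhd T S M B)ᶜ = 0 := by
      refine measure_mono_null (fun x hx => ?_) haper
      by_contra hne
      obtain ⟨k, hk⟩ := hcov x fun n hn h => hne ⟨n, hn, h⟩
      exact hx (hBA k hk)
    rw [measureReal_def, prob_compl_eq_zero_iff (measurableSet_orbitNhd hT.measurable hS M hB)
      |>.1 this, ENNReal.toReal_one]
  calc (1 : ℝ) = μ.real (orbitNhd T S M B) := hfull.symm
    _ ≤ ∑ i ∈ Finset.range M, μ.real (T^[i] ⁻¹' B ∪ S^[i] ⁻¹' B) :=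
        measureReal_biUnion_finset_le _ _
    _ ≤ ∑ i ∈ Finset.range M, (μ.real B + μ.real B) := by
        refine Finset.sum_le_sum fun i _ => ?_
        have := measureReal_union_le (μ := μ) (T^[i] ⁻¹' B) (S^[i] ⁻¹' B)
        rwa [hTB, hSB] at this
    _ = 2 * M * μ.real B := by
        rw [Finset.sum_const, Finset.card_range, nsmul_eq_mul]; ring

/-- A small modification of `E` on every `q`-th level of a tower produces entropy at rate
proportional to `1 / q` up to any prescribed time. -/
lemma exists_perturbation [StandardBorelSpace X] [IsProbabilityMeasure μ]
    (hT : MeasurePreserving T μ μ) (hS : Measurable S) (hST : Function.LeftInverse S T)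
    (haper : μ {x | ∃ n : ℕ, 1 ≤ n ∧ T^[n] x = x} = 0) {E : Set X} (hE : MeasurableSet E)
    {q : ℕ} (hq : 0 < q) (N₀ : ℕ) :
    ∃ E', MeasurableSet E' ∧ μ.real (symmDiff E' E) ≤ 1 / q ∧
      ∀ n ≤ N₀, (n : ℝ) / (16 * q) ≤ fibreEntropy μ (itinerary T E' n) := by
  classical
  set m := N₀ + 1 with hm
  have hm0 : 0 < m := by omega
  set N := q * m with hN
  have hN0 : 0 < N := Nat.mul_pos hq hm0
  obtain ⟨C, hC, hdisj, hμC⟩ := exists_tower hT hS hST haper (M := 2 * N) (by omega)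
  obtain ⟨c, hc, hcv⟩ := exists_equidistributed_code
    (measure_singleton_eq_zero_of_aperiodic hT haper) m hC
  have hTi : ∀ i {B : Set X}, MeasurableSet B → μ.real (T^[i] ⁻¹' B) = μ.real B := fun i B hB =>
    (hT.iterate i).measureReal_preimage hB.nullMeasurableSet
  have hpd : ∀ I : Finset ℕ, (∀ i ∈ I, i < 2 * N) →
      μ.real (⋃ i ∈ I, T^[i] ⁻¹' C) = I.card * μ.real C := fun I hI => by
    rw [measureReal_biUnion_finset]
    · simp only [hTi _ hC, Finset.sum_const, nsmul_eq_mul]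
    · intro i hi j hj hij
      exact disjoint_left.2 fun x h1 h2 => hij (hdisj i (hI i hi) j (hI j hj) x h1 h2)
    · exact fun i _ => hT.measurable.iterate i hC
  set W : ℕ → Set X := fun j => C ∩ c ⁻¹' {v | v ⟨j % m, Nat.mod_lt j hm0⟩ = true} with hW
  have hWm : ∀ j, MeasurableSet (W j) := fun j => hC.inter (hc (Set.toFinite _).measurableSet)
  set R : Set X := ⋃ j ∈ Finset.range (2 * m), T^[q * j] ⁻¹' C with hR
  have hRm : MeasurableSet R :=
    Finset.measurableSet_biUnion _ fun j _ => hT.measurable.iterate _ hC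
  set E' : Set X := (⋃ j ∈ Finset.range (2 * m), T^[q * j] ⁻¹' W j) ∪ (E \ R) with hE'
  have hE'm : MeasurableSet E' :=
    (Finset.measurableSet_biUnion _ fun j _ => hT.measurable.iterate _ (hWm j)).union (hE.diff hRm)
  have hqj : ∀ j, j < 2 * m → q * j < 2 * N := fun j hj => by
    have := Nat.mul_lt_mul_of_pos_left hj hq
    rw [hN]; linarith
  have hmem : ∀ j < 2 * m, ∀ x, T^[q * j] x ∈ C →
      (x ∈ E' ↔ c (T^[q * j] x) ⟨j % m, Nat.mod_lt j hm0⟩ = true) := by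
    intro j hj x hx
    have hxR : x ∈ R := mem_iUnion₂.2 ⟨j, Finset.mem_range.2 hj, hx⟩
    constructor
    · rintro (h | h)
      · obtain ⟨j', hj', hxC, hv⟩ := mem_iUnion₂.1 h
        have := hdisj _ (hqj j hj) _ (hqj j' (Finset.mem_range.1 hj')) x hx hxC
        obtain rfl := Nat.eq_of_mul_eq_mul_left hq this
        exact hv
      · exact absurd hxR h.2
    · exact fun h => Or.inl (mem_iUnion₂.2 ⟨j, Finset.mem_range.2 hj, hx, h⟩)
  have hNC : (2 * N : ℕ) * μ.real C ≤ 1 := by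
    rw [← Finset.card_range (2 * N), ← hpd _ fun i hi => Finset.mem_range.1 hi]
    exact measureReal_le_one
  have hq' : (0 : ℝ) < q := by exact_mod_cast hq
  have hNr : (N : ℝ) = q * m := by rw [hN]; push_cast; ring
  have hN0' : (0 : ℝ) < N := by exact_mod_cast hN0
  refine ⟨E', hE'm, ?_, ?_⟩
  · have hsub : symmDiff E' E ⊆ R := by
      intro x hx
      by_contra hxR
      have h1 : x ∉ ⋃ j ∈ Finset.range (2 * m), T^[q * j] ⁻¹' W j := fun h => by
        obtain ⟨j, hj, hxC, -⟩ := mem_iUnion₂.1 h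
        exact hxR (mem_iUnion₂.2 ⟨j, hj, hxC⟩)
      rcases mem_symmDiff.1 hx with ⟨h | h, h'⟩ | ⟨h, h'⟩
      · exact h1 h
      · exact h' h.1
      · exact h' (Or.inr ⟨h, hxR⟩)
    calc μ.real (symmDiff E' E) ≤ μ.real R := measureReal_mono hsub (measure_ne_top μ R)
      _ ≤ ∑ j ∈ Finset.range (2 * m), μ.real (T^[q * j] ⁻¹' C) :=
          measureReal_biUnion_finset_le _ _
      _ = 2 * m * μ.real C := by
          simp only [hTi _ hC, Finset.sum_const, nsmul_eq_mul, Finset.card_range]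
          push_cast; ring
      _ ≤ 1 / q := by
          rw [le_div_iff₀ hq']
          push_cast at hNC
          rw [hNr] at hNC
          linarith
  · set F : Set X := ⋃ i ∈ Finset.Ico N (2 * N), T^[i] ⁻¹' C with hF
    have hFm : MeasurableSet F :=
      Finset.measurableSet_biUnion _ fun i _ => hT.measurable.iterate _ hC
    have hμF : μ.real F = N * μ.real C := by
      rw [hF, hpd _ fun i hi => (Finset.mem_Ico.1 hi).2, Nat.card_Ico, two_mul,
        Nat.add_sub_cancel]
    have hcyl : ∀ s : Fin N → Bool, ∀ i ∈ Finset.Ico N (2 * N),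
        ∃ v : Fin m → Bool, itinerary T E' N ⁻¹' {s} ∩ T^[i] ⁻¹' C ⊆
          T^[i] ⁻¹' (C ∩ c ⁻¹' {v}) := by
      intro s i hi
      obtain ⟨hi1, hi2⟩ := Finset.mem_Ico.1 hi
      have hj : ∀ l : Fin m, ∃ j < 2 * m, j % m = l ∧ q * j ≤ i ∧ i < q * j + N := by
        intro l
        have hJ1 : m ≤ i / q := (Nat.le_div_iff_mul_le hq).2 (by rw [mul_comm]; exact hi1)
        have hJ2 : i / q < 2 * m := (Nat.div_lt_iff_lt_mul hq).2 (by rw [hN] at hi2; linarith)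
        have hl := l.2
        have hr := Nat.mod_lt (i / q - l) hm0
        have hdm := Nat.mod_add_div (i / q - l) m
        refine ⟨i / q - (i / q - l) % m, by omega, ?_, ?_, ?_⟩
        · have : i / q - (i / q - l) % m = l + m * ((i / q - l) / m) := by omega
          rw [this, Nat.add_mul_mod_self_left, Nat.mod_eq_of_lt hl]
        · exact (Nat.mul_le_mul_left q (Nat.sub_le _ _)).trans (Nat.mul_div_le i q)
        · have h1 : i < q * (i / q + 1) := Nat.lt_mul_div_succ i hq
          have h2 : i / q + 1 ≤ i / q - (i / q - l) % m + m := by omega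
          calc i < q * (i / q + 1) := h1
            _ ≤ q * (i / q - (i / q - l) % m + m) := Nat.mul_le_mul_left q h2
            _ = _ := by rw [mul_add]
      choose j hj1 hj2 hj3 hj4 using hj
      refine ⟨fun l => s ⟨i - q * j l, by have := hj3 l; have := hj4 l; omega⟩, ?_⟩
      rintro x ⟨hx, hxC⟩
      rw [itinerary_preimage_singleton] at hx
      refine ⟨hxC, funext fun l => ?_⟩
      have h1 := hx ⟨i - q * j l, by have := hj3 l; have := hj4 l; omega⟩
      have h2 : T^[q * j l] (T^[i - q * j l] x) = T^[i] x := by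
        rw [← Function.iterate_add_apply, Nat.add_sub_cancel' (hj3 l)]
      have h3 := hmem (j l) (hj1 l) (T^[i - q * j l] x) (by rw [h2]; exact hxC)
      rw [h2] at h3
      have h4 : (⟨j l % m, Nat.mod_lt _ hm0⟩ : Fin m) = l := Fin.ext (hj2 l)
      rw [h4] at h3
      exact Bool.eq_iff_iff.2 (h3.symm.trans h1)
    have hent : μ.real F * (m * log 2) ≤ fibreEntropy μ (itinerary T E' N) := by
      refine mul_le_fibreEntropy (measurable_itinerary hT.measurable hE'm N) hFm fun s => ?_
      have hexp : exp (-(m * log 2)) = 1 / 2 ^ m := by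
        rw [exp_neg, mul_comm, exp_mul, exp_log two_pos, rpow_natCast, one_div]
      rw [hexp, hF, inter_iUnion₂]
      calc _ ≤ ∑ i ∈ Finset.Ico N (2 * N), μ.real (itinerary T E' N ⁻¹' {s} ∩ T^[i] ⁻¹' C) :=
            measureReal_biUnion_finset_le _ _
        _ ≤ ∑ i ∈ Finset.Ico N (2 * N), μ.real C / 2 ^ m := by
            refine Finset.sum_le_sum fun i hi => ?_
            obtain ⟨v, hv⟩ := hcyl s i hi
            refine (measureReal_mono hv).trans ?_
            rw [hTi _ (hC.inter (hc (measurableSet_singleton v)))]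
            exact hcv v
        _ = μ.real F * (1 / 2 ^ m) := by
            rw [Finset.sum_const, nsmul_eq_mul, Nat.card_Ico, two_mul, Nat.add_sub_cancel, hμF]
            ring
    intro n hn
    have hnN : n ≤ N := by
      have : m ≤ N := Nat.le_mul_of_pos_left m hq
      omega
    have hrate := fibreEntropy_itinerary_rate hT hE'm hnN
    have hF4 : 1 / 4 ≤ μ.real F := by
      rw [hμF]
      push_cast at hμC
      linarith
    have hlog : (1 / 2 : ℝ) ≤ log 2 := by have := log_two_gt_d9; linarith
    have hm1 : (m : ℝ) / 8 ≤ fibreEntropy μ (itinerary T E' N) := by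
      refine le_trans ?_ hent
      have : (m : ℝ) * (1 / 2) ≤ m * log 2 := by gcongr
      have : (1 / 4 : ℝ) * (m * (1 / 2)) ≤ μ.real F * (m * log 2) := by gcongr
      linarith
    have h1 : (n : ℝ) * (m / 8) ≤ 2 * N * fibreEntropy μ (itinerary T E' n) :=
      le_trans (by gcongr) hrate
    rw [hNr] at h1
    have hm' : (0 : ℝ) < m := by exact_mod_cast hm0
    rw [div_le_iff₀ (by positivity)]
    refine le_of_mul_le_mul_right ?_ hm'
    linarith

end Towers

section Rates

variable {X : Type*} [MeasurableSpace X] {μ : Measure X} [IsProbabilityMeasure μ]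

lemma exists_fast_sequence : ∃ q : ℕ → ℕ, (∀ k, 0 < q k) ∧ (∀ k, 2 * q k ≤ q (k + 1)) ∧
    ∀ (k : ℕ) (x : ℝ), 0 ≤ x → x ≤ 2 / q (k + 1) → binEntropy x ≤ 1 / (32 * q k) := by
  have h : ∀ q : ℕ, 0 < q → ∃ p : ℕ, 2 * q ≤ p ∧
      ∀ x : ℝ, 0 ≤ x → x ≤ 2 / p → binEntropy x ≤ 1 / (32 * q) := by
    intro q hq
    have hpos : binEntropy 0 < 1 / (32 * (q : ℝ)) := by
      rw [binEntropy_zero]; positivity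
    obtain ⟨ε, hε, hball⟩ := Metric.eventually_nhds_iff.1
      (binEntropy_continuous.continuousAt.eventually_lt_const hpos)
    obtain ⟨p, hp⟩ := exists_nat_gt (2 / ε)
    refine ⟨2 * q + p, by omega, fun x hx hxp => (hball ?_).le⟩
    rw [Real.dist_eq, sub_zero, abs_of_nonneg hx]
    have hp' : 2 / ε < (2 * q + p : ℕ) := by
      have : (0 : ℝ) ≤ q := by positivity
      push_cast
      linarith
    exact hxp.trans_lt ((div_lt_comm₀ hε ((by positivity : 0 < 2 / ε).trans hp')).1 hp')
  choose! φ h1 h2 using h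
  have hpos : ∀ k, 0 < φ^[k] 1 := fun k => by
    induction k with
    | zero => exact one_pos
    | succ k ih =>
      rw [Function.iterate_succ_apply']
      have := h1 _ ih
      omega
  refine ⟨fun k => φ^[k] 1, hpos, fun k => ?_, fun k => ?_⟩ <;>
    simp only [Function.iterate_succ_apply']
  · exact h1 _ (hpos k)
  · exact h2 _ (hpos k)

lemma exists_limit_set {F : ℕ → Set X} (hF : ∀ k, MeasurableSet (F k)) :
    ∃ E, MeasurableSet E ∧ ∀ k (d : ℝ),
      (∀ i, μ.real (symmDiff (F (k + i + 1)) (F (k + i))) ≤ d / 2 * (1 / 2) ^ i) →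
      μ.real (symmDiff E (F k)) ≤ d := by
  refine ⟨⋃ k, ⋂ j, F (k + j), MeasurableSet.iUnion fun k => MeasurableSet.iInter fun j => hF _,
    fun k d h => ?_⟩
  have hd : 0 ≤ d / 2 := by simpa using measureReal_nonneg.trans (h 0)
  have hsub : symmDiff (⋃ k, ⋂ j, F (k + j)) (F k) ⊆
      ⋃ i, symmDiff (F (k + i + 1)) (F (k + i)) := by
    intro x hx
    by_contra hne
    have hstep : ∀ i, x ∈ F (k + i + 1) ↔ x ∈ F (k + i) := fun i => by
      have h1 : x ∉ symmDiff (F (k + i + 1)) (F (k + i)) := fun h => hne (mem_iUnion_of_mem i h)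
      rw [mem_symmDiff] at h1
      tauto
    have hall : ∀ i, x ∈ F (k + i) ↔ x ∈ F k := fun i => by
      induction i with
      | zero => rfl
      | succ i ih => rw [← ih, ← hstep i]; rfl
    rcases mem_symmDiff.1 hx with ⟨h1, h2⟩ | ⟨h1, h2⟩
    · obtain ⟨l, hl⟩ := mem_iUnion.1 h1
      have := mem_iInter.1 hl k
      rw [add_comm, hall] at this
      exact h2 this
    · exact h2 (mem_iUnion_of_mem k (mem_iInter.2 fun j => (hall j).2 h1))
  have hsum : HasSum (fun i : ℕ => d / 2 * (1 / 2 : ℝ) ^ i) d := by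
    simpa using hasSum_geometric_two.mul_left (d / 2)
  refine ENNReal.toReal_le_of_le_ofReal (by linarith) ?_
  calc μ (symmDiff (⋃ k, ⋂ j, F (k + j)) (F k))
      ≤ ∑' i, μ (symmDiff (F (k + i + 1)) (F (k + i))) :=
        (measure_mono hsub).trans (measure_iUnion_le _)
    _ ≤ ∑' i, ENNReal.ofReal (d / 2 * (1 / 2) ^ i) := ENNReal.tsum_le_tsum fun i =>
        (ENNReal.le_ofReal_iff_toReal_le (measure_ne_top _ _) (by positivity)).2 (h i)
    _ = ENNReal.ofReal d := by
        rw [← ENNReal.ofReal_tsum_of_nonneg (fun i => by positivity) hsum.summable, hsum.tsum_eq]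

/-- Every sublinear rate is beaten by the entropy of some binary partition. -/
lemma exists_fibreEntropy_div_tendsto_atTop [StandardBorelSpace X] {T S : X → X}
    (hT : MeasurePreserving T μ μ) (hS : Measurable S) (hST : Function.LeftInverse S T)
    (haper : μ {x | ∃ n : ℕ, 1 ≤ n ∧ T^[n] x = x} = 0) {a : ℕ → ℝ} (hapos : ∀ n, 0 < a n)
    (hsub : Tendsto (fun n => a n / n) atTop (nhds 0)) :
    ∃ E, MeasurableSet E ∧
      Tendsto (fun n => fibreEntropy μ (itinerary T E n) / a n) atTop atTop := by
  obtain ⟨q, hq0, hq2, hqb⟩ := exists_fast_sequence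
  have hq0' : ∀ k, (0 : ℝ) < q k := fun k => by exact_mod_cast hq0 k
  have hN : ∀ k : ℕ, ∃ N : ℕ, k ≤ N ∧ ∀ n ≥ N, (k + 1) * a n ≤ n / (32 * q (k + 1)) := by
    intro k
    have hpos : (0 : ℝ) < 1 / (32 * q (k + 1) * (k + 1)) := by
      have := hq0' (k + 1)
      positivity
    obtain ⟨N, hN⟩ := eventually_atTop.1 (hsub.eventually_lt_const hpos)
    refine ⟨max N (k + 1), by omega, fun n hn => ?_⟩
    have hn0 : (0 : ℝ) < n := by
      have : 0 < n := by omega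
      exact_mod_cast this
    have h := hN n (le_of_max_le_left hn)
    have h0 := hq0' (k + 1)
    rw [div_lt_div_iff₀ hn0 (by positivity)] at h
    rw [le_div_iff₀ (by positivity)]
    linarith
  choose N hNk hNa using hN
  have hpert := fun k (E : {E : Set X // MeasurableSet E}) =>
    exists_perturbation hT hS hST haper E.2 (hq0 k) (N k)
  choose P hPm hPd hPe using hpert
  let F : ℕ → {E : Set X // MeasurableSet E} := fun k =>
    Nat.rec ⟨∅, MeasurableSet.empty⟩ (fun k E => ⟨P k E, hPm k E⟩) k
  have hFd : ∀ k, μ.real (symmDiff (F (k + 1)).1 (F k).1) ≤ 1 / q k := fun k => hPd k (F k)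
  have hFe : ∀ k, ∀ n ≤ N k,
      (n : ℝ) / (16 * q k) ≤ fibreEntropy μ (itinerary T (F (k + 1)).1 n) := fun k => hPe k (F k)
  obtain ⟨E, hE, hEF⟩ := exists_limit_set (μ := μ) fun k => (F k).2
  have hqgrow : ∀ k i, 2 ^ i * q k ≤ q (k + i) := fun k i => by
    induction i with
    | zero => simp
    | succ i ih =>
      have := hq2 (k + i)
      rw [pow_succ, ← add_assoc]
      linarith
  have hdist : ∀ k, μ.real (symmDiff (F (k + 1)).1 E) ≤ 2 / q (k + 1) := fun k => by
    rw [symmDiff_comm]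
    refine hEF (k + 1) _ fun i => (hFd (k + 1 + i)).trans ?_
    have h1 : (2 : ℝ) ^ i * q (k + 1) ≤ q (k + 1 + i) := by exact_mod_cast hqgrow (k + 1) i
    have h2 := hq0' (k + 1)
    calc 1 / (q (k + 1 + i) : ℝ) ≤ 1 / (2 ^ i * q (k + 1)) :=
          one_div_le_one_div_of_le (by positivity) h1
      _ = 2 / q (k + 1) / 2 * (1 / 2) ^ i := by
          rw [one_div_pow]; field_simp
  have hent : ∀ k, ∀ n ≤ N k, (n : ℝ) / (32 * q k) ≤ fibreEntropy μ (itinerary T E n) := by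
    intro k n hn
    have h1 := hFe k n hn
    have h2 := fibreEntropy_itinerary_le_add hT (F (k + 1)).2 hE n
    have h3 : (n : ℝ) * binEntropy (μ.real (symmDiff (F (k + 1)).1 E)) ≤ n * (1 / (32 * q k)) := by
      gcongr
      exact hqb k _ measureReal_nonneg (hdist k)
    have h0 := hq0' k
    have h4 : (n : ℝ) / (16 * q k) = n / (32 * q k) + n * (1 / (32 * q k)) := by
      field_simp; ring
    linarith
  refine ⟨E, hE, tendsto_atTop.2 fun b => ?_⟩
  obtain ⟨K, hK⟩ := exists_nat_ge b
  filter_upwards [eventually_ge_atTop (N K)] with n hn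
  have hex : ∃ k, K < k ∧ n < N k :=
    ⟨K + n + 1, by omega, lt_of_lt_of_le (by omega) (hNk (K + n + 1))⟩
  classical
  obtain ⟨k, hk⟩ := Nat.exists_eq_succ_of_ne_zero
    (Nat.ne_of_gt ((Nat.zero_le K).trans_lt (Nat.find_spec hex).1))
  have hspec := Nat.find_spec hex
  have hmin : ¬(K < k ∧ n < N k) := Nat.find_min hex (by omega)
  rw [hk] at hspec
  have hKk : K ≤ k := Nat.lt_succ_iff.1 hspec.1
  have hNn : N k ≤ n := by
    rcases hKk.eq_or_lt with rfl | h
    · exact hn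
    · exact not_lt.1 fun h' => hmin ⟨h, h'⟩
  rw [le_div_iff₀ (hapos n)]
  have hKk' : (K : ℝ) ≤ k := by exact_mod_cast hKk
  calc b * a n ≤ (k + 1) * a n := mul_le_mul_of_nonneg_right (by linarith) (hapos n).le
    _ ≤ n / (32 * q (k + 1)) := hNa k n hNn
    _ ≤ _ := hent (k + 1) n hspec.2.le

end Rates

section Comparison

/-- A concave function comparable to the Shannon function at `0` dominates a multiple of it up to
a linear term. -/
lemma exists_mul_negMulLog_sub_le {g : ℝ → ℝ} (hconc : ConcaveOn ℝ (Icc 0 1) g) (hg0 : g 0 = 0)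
    {L : ℝ} (hL : 0 < L)
    (hlim : Tendsto (fun x => g x / shannonF x) (nhdsWithin 0 (Ioi 0)) (nhds L)) :
    ∃ c K : ℝ, 0 < c ∧ 0 ≤ K ∧ ∀ x ∈ Icc (0 : ℝ) 1, c * negMulLog x - K * x ≤ g x := by
  have hlog : 0 < log 2 := log_pos one_lt_two
  have hev : ∀ᶠ x in nhdsWithin 0 (Ioi 0), L / 2 < g x / shannonF x :=
    hlim.eventually_const_lt (half_lt_self hL)
  obtain ⟨u, hu, hsub⟩ := mem_nhdsGT_iff_exists_Ioo_subset.1 hev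
  set δ := min u 1
  have hδ : 0 < δ := lt_min hu one_pos
  have hδ1 : 0 ≤ -log δ := neg_nonneg.2 (log_nonpos hδ.le (min_le_right _ _))
  set c := L / 2 / log 2
  have hc : 0 < c := by positivity
  refine ⟨c, |g 1| + c * -log δ, hc, by positivity, fun x hx => ?_⟩
  rcases hx.1.eq_or_lt with rfl | hx0
  · simp [hg0]
  have hK : 0 ≤ (|g 1| + c * -log δ) * x := by positivity
  rcases lt_or_ge x δ with hxδ | hxδ
  · have h1 : L / 2 < g x / shannonF x := hsub ⟨hx0, hxδ.trans_le (min_le_left _ _)⟩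
    have hsh : shannonF x = negMulLog x / log 2 := by
      rw [shannonF, negMulLog, logb]; ring
    have hpos : 0 < negMulLog x := by
      rw [negMulLog, neg_mul, neg_pos]
      exact mul_log_neg hx0 (hxδ.trans_le (min_le_right _ _))
    rw [hsh, lt_div_iff₀ (by positivity)] at h1
    have : c * negMulLog x = L / 2 * (negMulLog x / log 2) := by simp only [c]; ring
    linarith
  · have h1 := hconc.2 (x := 0) (y := 1) (by simp) (by simp) (sub_nonneg.2 hx.2) hx0.le
      (by ring)
    simp only [smul_eq_mul, hg0, mul_zero, zero_add, mul_one] at h1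
    have h2 : negMulLog x ≤ x * -log δ := by
      rw [negMulLog, neg_mul, ← mul_neg]
      gcongr
    have h3 : x * -|g 1| ≤ x * g 1 := by gcongr; exact neg_abs_le _
    have h4 := mul_le_mul_of_nonneg_left h2 hc.le
    linarith

lemma mul_fibreEntropy_sub_le_binEnt {X : Type*} [MeasurableSpace X] {μ : Measure X}
    [IsProbabilityMeasure μ] {T : X → X} (hT : Measurable T) {E : Set X} (hE : MeasurableSet E)
    {g : ℝ → ℝ} {c K : ℝ} (h : ∀ x ∈ Icc (0 : ℝ) 1, c * negMulLog x - K * x ≤ g x) (n : ℕ) :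
    c * fibreEntropy μ (itinerary T E n) - K ≤ binEnt μ T g E n := by
  have h1 := sum_real_fibre (μ := μ) (measurable_itinerary hT hE n)
  calc c * fibreEntropy μ (itinerary T E n) - K
      = ∑ s, (c * negMulLog (μ.real (itinerary T E n ⁻¹' {s})) -
          K * μ.real (itinerary T E n ⁻¹' {s})) := by
        rw [Finset.sum_sub_distrib, ← Finset.mul_sum, ← Finset.mul_sum, h1, mul_one, fibreEntropy]
    _ ≤ binEnt μ T g E n := Finset.sum_le_sum fun s _ => by
        rw [itinerary_preimage_singleton]
        exact h _ ⟨measureReal_nonneg, measureReal_le_one⟩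

end Comparison

end PartitionEntropy

/-- For every aperiodic invertible measure-preserving transformation of a standard
probability space, every entropy function `g ∈ G₀^sh` (i.e. `lim_{x→0⁺} g(x)/η(x) ∈ (0,∞)`),
and every strictly increasing sequence `(aₙ)` of positive reals with sublinear growth,
there exists a binary partition `P^E = {E, Eᶜ}` with `lim H(g, Pₙ^E)/aₙ = ∞`. -/
theorem statement2 {X : Type*} [MeasurableSpace X] [StandardBorelSpace X]
    (μ : Measure X) [IsProbabilityMeasure μ] (T : X → X)
    (hT : MeasurePreserving T μ μ)
    (hinv : ∃ S : X → X, Measurable S ∧ Function.LeftInverse S T ∧ Function.RightInverse S T)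
    (haper : μ {x | ∃ n : ℕ, 1 ≤ n ∧ T^[n] x = x} = 0)
    (g : ℝ → ℝ) (hconc : ConcaveOn ℝ (Set.Icc 0 1) g) (hg0 : g 0 = 0)
    (hg0' : Tendsto g (nhdsWithin 0 (Set.Ioi 0)) (nhds 0))
    (hsh : ∃ L : ℝ, 0 < L ∧
      Tendsto (fun x => g x / shannonF x) (nhdsWithin 0 (Set.Ioi 0)) (nhds L))
    (a : ℕ → ℝ) (hamono : StrictMono a) (hapos : ∀ n, 0 < a n)
    (hatop : Tendsto a atTop atTop)
    (hsub : Tendsto (fun n => a n / n) atTop (nhds 0)) :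
    ∃ E : Set X, MeasurableSet E ∧ 0 < μ E ∧ μ E < 1 ∧
      Tendsto (fun n => binEnt μ T g E n / a n) atTop atTop := by
  obtain ⟨S, hS, hST, -⟩ := hinv
  obtain ⟨L, hL, hlim⟩ := hsh
  obtain ⟨c, K, hc, hK, hcK⟩ := PartitionEntropy.exists_mul_negMulLog_sub_le hconc hg0 hL hlim
  obtain ⟨E, hE, hEa⟩ :=
    PartitionEntropy.exists_fibreEntropy_div_tendsto_atTop hT hS hST haper hapos hsub
  have hne : Real.binEntropy (μ.real E) ≠ 0 := fun h0 => by
    obtain ⟨n, hn⟩ := (hEa.eventually_ge_atTop 1).exists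
    have h := PartitionEntropy.fibreEntropy_itinerary_le hT hE n
    rw [h0, mul_zero] at h
    have := div_nonpos_of_nonpos_of_nonneg h (hapos n).le
    linarith
  rw [Ne, Real.binEntropy_eq_zero, not_or] at hne
  refine ⟨E, hE, ?_, ?_, ?_⟩
  · exact pos_iff_ne_zero.2 fun h => hne.1 (by simp [measureReal_def, h])
  · exact lt_of_le_of_ne prob_le_one fun h => hne.2 (by simp [measureReal_def, h])
  · refine tendsto_atTop_mono (fun n => ?_)
      (tendsto_atTop_add_const_right _ (-(K / a 0)) (hEa.const_mul_atTop hc))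
    have h1 := PartitionEntropy.mul_fibreEntropy_sub_le_binEnt (μ := μ) hT.measurable hE hcK n
    have h2 : K / a n ≤ K / a 0 :=
      div_le_div_of_nonneg_left hK (hapos 0) (hamono.monotone (Nat.zero_le n))
    have h3 := div_le_div_of_nonneg_right h1 (hapos n).le
    rw [sub_div, mul_div_assoc] at h3
    linarith
end

section
/- Let T be an invertible measure-preserving transformation of the unit interval [0,1] with Lebesgue measure μ such that T^n is ergodic for every n ≥ 1 (completely ergodic), and let ε > 0. Then there exists a strictly increasing sequence (N_n) of natural numbers such that for every measurable set E ⊆ [0,1] with 0 < μ(E) < 1 there exists K ∈ ℕ such that for all n ≥ K, μ({x ∈ [0,1] : p_{2^{N_n}}(s_{2^{N_n}}^E(x)) ≤ 2^{2^n}}) < ε. -/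
open MeasureTheory Filter Set

/-- `periodLE T E m K x` says that the period `p_m(s_m^E(x))` of the 01-name of length `m`
of `x` with respect to `E` is at most `K`: either `m ≤ K` (the period is always at most
`m`), or there is `k ∈ {1,…,m−1}` with `k ≤ K` such that `s_i = s_{i+k}` for all
`0 ≤ i ≤ m−k−1`, where `s_i = 1_E(T^i x)`. -/
def periodLE {X : Type*} (T : X → X) (E : Set X) (m K : ℕ) (x : X) : Prop :=
  m ≤ K ∨ ∃ k : ℕ, 1 ≤ k ∧ k ≤ K ∧ k < m ∧
    ∀ i : ℕ, i + k < m → ((T^[i] x ∈ E) ↔ (T^[i + k] x ∈ E))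

open scoped Topology ENNReal

/-- Nonexpansive maps converging pointwise along each row of a double sequence converge pointwise
along a single diagonal, provided the space is separable. -/
theorem exists_diagonal_tendsto_of_lipschitzWith_one {H : Type*} [PseudoMetricSpace H]
    [TopologicalSpace.SeparableSpace H] {B : ℕ → ℕ → H → H} {P : H → H}
    (hB : ∀ n m, LipschitzWith 1 (B n m))
    (hP : ∀ n f, Tendsto (fun m => B n m f) atTop (𝓝 (P f))) :
    ∃ M : ℕ → ℕ, ∀ f, Tendsto (fun n => B n (M n) f) atTop (𝓝 (P f)) := by
  rcases isEmpty_or_nonempty H with hH | hH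
  · exact ⟨0, fun f => isEmptyElim f⟩
  have hPlip : ∀ f g, dist (P f) (P g) ≤ dist f g := fun f g =>
    le_of_tendsto ((hP 0 f).dist (hP 0 g)) <| Eventually.of_forall fun m => by
      simpa using (hB 0 m).dist_le_mul f g
  let u := TopologicalSpace.denseSeq H
  have hM : ∀ n, ∃ m, ∀ j ∈ Finset.range (n + 1),
      dist (B n m (u j)) (P (u j)) < 1 / ((n : ℝ) + 1) := fun n =>
    (((Finset.range (n + 1)).eventually_all).2 fun j _ =>
      Metric.tendsto_nhds.1 (hP n (u j)) _ (by positivity)).exists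
  choose M hM using hM
  refine ⟨M, fun f => Metric.tendsto_nhds.2 fun δ hδ => ?_⟩
  obtain ⟨j, hj⟩ := (TopologicalSpace.denseRange_denseSeq H).exists_dist_lt f
    (show 0 < δ / 3 by positivity)
  filter_upwards [eventually_ge_atTop j,
    tendsto_one_div_add_atTop_nhds_zero_nat.eventually_lt_const (show 0 < δ / 3 by positivity)]
    with n hn hn'
  have h1 : dist (B n (M n) f) (B n (M n) (u j)) ≤ dist f (u j) := by
    simpa using (hB n (M n)).dist_le_mul f (u j)
  have h2 := hM n j (Finset.mem_range.2 (by omega))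
  have h3 := hPlip (u j) f
  rw [dist_comm (u j) f] at h3
  have h4 := dist_triangle4 (B n (M n) f) (B n (M n) (u j)) (P (u j)) (P f)
  change dist f (u j) < δ / 3 at hj
  linarith

/-- Birkhoff averages along the orbits of a nonexpansive linear map are nonexpansive. -/
theorem lipschitzWith_one_birkhoffAverage {H : Type*} [NormedAddCommGroup H] [NormedSpace ℝ H]
    {U : H → H} (hU : LipschitzWith 1 U) (n : ℕ) :
    LipschitzWith 1 (birkhoffAverage ℝ U id n) := by
  refine LipschitzWith.of_dist_le_mul fun x y => ?_
  refine (dist_birkhoffAverage_birkhoffAverage_le ℝ U id n x y).trans ?_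
  refine div_le_of_le_mul₀ (by positivity) (by positivity) ?_
  refine (Finset.sum_le_card_nsmul _ _ (dist x y) fun k _ => ?_).trans ?_
  · simpa using (hU.iterate k).dist_le_mul x y
  · simp [mul_comm]

section Koopman

variable {X : Type*} [MeasurableSpace X] {μ : Measure X} [IsProbabilityMeasure μ] {S : X → X}

/-- The mean ergodic theorem for an ergodic map: the averages converge to the integral. -/
theorem Ergodic.tendsto_birkhoffAverage_Lp (hS : Ergodic S μ) (f : Lp ℝ 2 μ) :
    Tendsto (fun m => birkhoffAverage ℝ
      (Lp.compMeasurePreserving (E := ℝ) (p := 2) S hS.toMeasurePreserving) id m f) atTop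
      (𝓝 (Lp.const 2 μ (∫ x, f x ∂μ))) := by
  let U : Lp ℝ 2 μ →L[ℝ] Lp ℝ 2 μ :=
    (Lp.compMeasurePreservingₗᵢ ℝ S hS.toMeasurePreserving).toContinuousLinearMap
  let F := U.eqLocus (1 : Lp ℝ 2 μ →L[ℝ] Lp ℝ 2 μ)
  have key := U.tendsto_birkhoffAverage_orthogonalProjection
    (LinearIsometry.norm_toContinuousLinearMap_le _) f
  obtain ⟨v, hv⟩ : ∃ v, v = F.orthogonalProjectionOnto f := ⟨_, rfl⟩
  obtain ⟨a, ha⟩ : ∃ a, (v : Lp ℝ 2 μ) = Lp.const 2 μ a := by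
    have hfix : Lp.compMeasurePreserving S hS.toMeasurePreserving (v : Lp ℝ 2 μ) = v := v.2
    obtain ⟨a, ha⟩ := hS.eq_const_of_compMeasurePreserving_eq (congrArg Subtype.val hfix)
    exact ⟨a, Subtype.ext ha⟩
  have hone : Lp.const 2 μ (1 : ℝ) ∈ F := by
    change Lp.compMeasurePreserving S hS.toMeasurePreserving (Lp.const 2 μ (1 : ℝ)) = _
    rfl
  have horth : inner ℝ (Lp.const 2 μ (1 : ℝ)) (f - v) = 0 := by
    rw [hv]
    exact (F.sub_starProjection_mem_orthogonal f) _ hone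
  have hint : ∀ g : Lp ℝ 2 μ, inner ℝ (Lp.const 2 μ (1 : ℝ)) g = ∫ x, g x ∂μ := fun g => by
    rw [← indicatorConstLp_univ, L2.inner_indicatorConstLp_one, setIntegral_univ]
  have hconst : ∫ x, (Lp.const 2 μ a : Lp ℝ 2 μ) x ∂μ = a := by
    rw [integral_congr_ae (Lp.coeFn_const (p := 2) (μ := μ) (c := a))]
    simp
  rw [inner_sub_right, hint, hint, ha, hconst, sub_eq_zero] at horth
  rw [horth, ← ha, hv]
  exact key

/-- Averages of an indicator function in `L²` are given by the pointwise averages. -/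
theorem coeFn_birkhoffAverage_indicatorConstLp (hS : MeasurePreserving S μ μ) {E : Set X}
    (hE : MeasurableSet E) (m : ℕ) :
    (birkhoffAverage ℝ (Lp.compMeasurePreserving (E := ℝ) (p := 2) S hS) id m
      (indicatorConstLp 2 hE (measure_ne_top μ E) 1) : Lp ℝ 2 μ) =ᵐ[μ]
      birkhoffAverage ℝ S (E.indicator 1) m := by
  have hterm : ∀ k : ℕ, ((Lp.compMeasurePreserving (E := ℝ) (p := 2) S hS)^[k]
      (indicatorConstLp 2 hE (measure_ne_top μ E) 1) : Lp ℝ 2 μ) =ᵐ[μ]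
      fun x => E.indicator (1 : X → ℝ) (S^[k] x) := fun k => by
    rw [Lp.compMeasurePreserving_iterate, Lp.indicatorConstLp_compMeasurePreserving]
    exact indicatorConstLp_coeFn
  refine (Lp.coeFn_smul _ _).trans ?_
  have hsum := Lp.coeFn_finsetSum (Finset.range m) fun k =>
    (Lp.compMeasurePreserving (E := ℝ) (p := 2) S hS)^[k]
      (indicatorConstLp 2 hE (measure_ne_top μ E) 1)
  filter_upwards [hsum, ae_all_iff.2 hterm] with x hx hx'
  simp only [Pi.smul_apply, birkhoffAverage, birkhoffSum, id]
  rw [hx]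
  simp [hx']

end Koopman

/-- A small period of the name forces membership in `E` to be constant along the orbit of any
iterate whose exponent is a multiple of all candidate periods. -/
theorem periodLE.iterate_mem_iff {X : Type*} {T : X → X} {E : Set X} {m K q M : ℕ} {x : X}
    (h : periodLE T E m K x) (hK : K < m) (hq : 0 < q) (hdvd : ∀ k, 1 ≤ k → k ≤ K → k ∣ q)
    (hm : q * M ≤ m) {j : ℕ} (hj : j < M) : (T^[q])^[j] x ∈ E ↔ x ∈ E := by
  obtain h | ⟨k, hk1, hkK, -, hper⟩ := h
  · omega
  obtain ⟨l, rfl⟩ := hdvd k hk1 hkK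
  have hmul : ∀ t, k * t < m → (T^[k * t] x ∈ E ↔ x ∈ E) := by
    intro t
    induction t with
    | zero => simp
    | succ t ih =>
      intro ht
      rw [mul_add_one] at ht ⊢
      rw [← hper _ ht]
      exact ih (by omega)
  rw [← Function.iterate_mul, mul_assoc]
  refine hmul (l * j) (lt_of_lt_of_le ?_ hm)
  rw [← mul_assoc]
  exact Nat.mul_lt_mul_of_pos_left hj hq

/-- The average of an indicator is `0` or `1` when membership is constant along the orbit. -/
theorem birkhoffAverage_indicator_eq_zero_or_one {X : Type*} {S : X → X} {E : Set X} {m : ℕ}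
    {x : X} (h : ∀ j < m, S^[j] x ∈ E ↔ x ∈ E) :
    birkhoffAverage ℝ S (E.indicator (1 : X → ℝ)) m x = 0 ∨ birkhoffAverage ℝ S (E.indicator (1 : X → ℝ)) m x = 1 := by
  rcases Nat.eq_zero_or_pos m with rfl | hm
  · simp
  have hsum : birkhoffSum S (E.indicator (1 : X → ℝ)) m x = m * E.indicator 1 x := by
    rw [birkhoffSum, Finset.sum_congr rfl fun j hj => ?_, Finset.sum_const, Finset.card_range,
      nsmul_eq_mul]
    have hiff := h j (Finset.mem_range.1 hj)
    by_cases hx : x ∈ E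
    · simp [hx, hiff.2 hx]
    · simp [hx, mt hiff.1 hx]
  have hm' : (m : ℝ) ≠ 0 := by positivity
  by_cases hx : x ∈ E <;> simp [birkhoffAverage, hsum, hx, hm']

/-- For every invertible, completely ergodic measure-preserving transformation `T` of the
unit interval with Lebesgue measure and every `ε > 0`, there is a strictly increasing
sequence `(Nₙ)` of naturals such that for every measurable `E` with `0 < μ(E) < 1` there
is `K` with `μ({x : p_{2^{Nₙ}}(s_{2^{Nₙ}}^E(x)) ≤ 2^{2^n}}) < ε` for all `n ≥ K`. -/
theorem statement7 (T : Set.Icc (0:ℝ) 1 → Set.Icc (0:ℝ) 1)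
    (hT : MeasurePreserving T volume volume)
    (hinv : ∃ S : Set.Icc (0:ℝ) 1 → Set.Icc (0:ℝ) 1,
      Measurable S ∧ Function.LeftInverse S T ∧ Function.RightInverse S T)
    (herg : ∀ n : ℕ, 1 ≤ n → Ergodic (T^[n]) volume)
    (ε : ℝ) (hε : 0 < ε) :
    ∃ N : ℕ → ℕ, StrictMono N ∧
      ∀ E : Set (Set.Icc (0:ℝ) 1), MeasurableSet E → 0 < volume E → volume E < 1 →
        ∃ K : ℕ, ∀ n : ℕ, K ≤ n →
          volume {x | periodLE T E (2 ^ N n) (2 ^ 2 ^ n) x} < ENNReal.ofReal ε := by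
  set μ : Measure (Set.Icc (0:ℝ) 1) := volume
  let q : ℕ → ℕ := fun n => (2 ^ 2 ^ n).factorial
  have hq : ∀ n, 0 < q n := fun n => Nat.factorial_pos _
  have hS : ∀ n, Ergodic (T^[q n]) μ := fun n => herg _ (hq n)
  have : Fact ((2 : ℝ≥0∞) ≠ ∞) := ⟨by simp⟩
  obtain ⟨M, hM⟩ := exists_diagonal_tendsto_of_lipschitzWith_one
    (fun n m => lipschitzWith_one_birkhoffAverage
      (Lp.isometry_compMeasurePreserving (E := ℝ) (p := 2) (hS n).toMeasurePreserving).lipschitz m)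
    (fun n f => (hS n).tendsto_birkhoffAverage_Lp f)
  let N : ℕ → ℕ := fun n => ∑ i ∈ Finset.range (n + 1), (q i * M i + 2 ^ i + 1)
  have hNge : ∀ n, q n * M n + 2 ^ n + 1 ≤ N n := fun n =>
    Finset.single_le_sum (f := fun i => q i * M i + 2 ^ i + 1) (fun _ _ => Nat.zero_le _)
      (Finset.self_mem_range_succ n)
  refine ⟨N, strictMono_nat_of_lt_succ fun n => ?_, fun E hE hE0 hE1 => ?_⟩
  · simp only [N]
    rw [Finset.sum_range_succ _ (n + 1)]
    exact Nat.lt_add_of_pos_right (Nat.succ_pos _)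
  have hfreal : ∫ x, (indicatorConstLp 2 hE (measure_ne_top μ E) (1 : ℝ)) x ∂μ = μ.real E := by
    rw [integral_indicatorConstLp]
    simp
  have h0 : 0 < μ.real E := ENNReal.toReal_pos hE0.ne' (measure_ne_top μ E)
  have h1 : μ.real E < 1 := by
    simpa [Measure.real] using (ENNReal.toReal_lt_toReal (measure_ne_top μ E) ENNReal.one_ne_top).2 hE1
  have hlim := tendstoInMeasure_iff_dist.1
    (tendstoInMeasure_of_tendsto_Lp (hM (indicatorConstLp 2 hE (measure_ne_top μ E) 1)))
    (min (μ.real E) (1 - μ.real E)) (lt_min h0 (sub_pos.2 h1))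
  obtain ⟨K, hK⟩ := eventually_atTop.1
    (hlim.eventually_lt_const (ENNReal.ofReal_pos.2 hε))
  refine ⟨K, fun n hn => (measure_mono_ae ?_).trans_lt (hK n hn)⟩
  have hqM : q n * M n ≤ 2 ^ N n := by
    refine le_trans ?_ ((hNge n).trans Nat.lt_two_pow_self.le)
    rw [add_assoc]
    exact Nat.le_add_right _ _
  have hlt : 2 ^ n < N n := by
    refine lt_of_lt_of_le ?_ (hNge n)
    rw [add_assoc, ← add_assoc, Nat.lt_succ_iff]
    exact Nat.le_add_left _ _
  filter_upwards [coeFn_birkhoffAverage_indicatorConstLp (hS n).toMeasurePreserving hE (M n),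
    Lp.coeFn_const (p := 2) (μ := μ)
      (c := ∫ x, (indicatorConstLp 2 hE (measure_ne_top μ E) (1 : ℝ)) x ∂μ)] with x hx hx' hper
  have hcases := birkhoffAverage_indicator_eq_zero_or_one fun j hj =>
    periodLE.iterate_mem_iff (M := M n) hper
      (Nat.pow_lt_pow_right one_lt_two hlt) (hq n)
      (fun k hk hk' => Nat.dvd_factorial hk hk') hqM hj
  change _ ≤ dist _ _
  rw [hx, hx', hfreal, Function.const_apply, Real.dist_eq]
  rcases hcases with h | h <;> rw [h]
  · rw [zero_sub, abs_neg, abs_of_pos h0]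
    exact min_le_left _ _
  · rw [abs_of_pos (sub_pos.2 h1)]
    exact min_le_right _ _
end
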